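/- Let q be a power of an odd prime, m ≥ 2, and let f(x) = a·x^2 + b·x + c with a, b, c ∈ F_{q^m}, a ≠ 0 and b^2 − 4ac ≠ 0. Let e_1 and e_2 be divisors of q^m − 1 and let g be a monic divisor of x^m − 1 in F_q[x]. Let N(e_1, e_2, g) denote the number of α ∈ F_{q^m} such that α is e_1-free and g-free and f(α) is e_2-free. Then N(e_1, e_2, g) ≥ θ(e_1)·θ(e_2)·Θ(g)·q^{m/2}·( q^{m/2} − 3·W(e_1)·W(e_2)·Ω(g) ). -/

import Mathlib

open Polynomial

/-- For `e ∣ q^m - 1`, a nonzero element `α` of `F_{q^m}` is *e-free* if whenever `d ∣ e` and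
`α = β^d` for some `β`, then `d = 1`. -/
def IsEFree {K : Type*} [Field K] (e : ℕ) (α : K) : Prop :=
  α ≠ 0 ∧ ∀ d : ℕ, d ∣ e → (∃ β : K, α = β ^ d) → d = 1

/-- The additive `F_q[x]`-module action on `F_{q^m}`: `h ∘ α = Σ aᵢ α^{qⁱ}` for
`h = Σ aᵢ xⁱ ∈ F_q[x]`. -/
noncomputable def polyAct (F : Type*) {K : Type*} [Field F] [Fintype F] [Field K] [Algebra F K]
    (h : Polynomial F) (α : K) : K :=
  h.sum fun i a => algebraMap F K a * α ^ (Fintype.card F) ^ i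

/-- For a monic divisor `g` of `x^m - 1`, an element `α ∈ F_{q^m}` is *g-free* if whenever
`h` is a monic divisor of `g` and `α = h ∘ β` for some `β`, then `h = 1`. -/
def IsGFree (F : Type*) {K : Type*} [Field F] [Fintype F] [Field K] [Algebra F K]
    (g : Polynomial F) (α : K) : Prop :=
  ∀ h : Polynomial F, h.Monic → h ∣ g → (∃ β : K, α = polyAct F h β) → h = 1

/-- `NCount F a b c e₁ e₂ g` is the number of `α ∈ K` such that `α` is `e₁`-free and `g`-free
and `f(α) = a α² + b α + c` is `e₂`-free. -/
noncomputable def NCount (F : Type*) {K : Type*} [Field F] [Fintype F] [Field K] [Algebra F K]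
    (a b c : K) (e₁ e₂ : ℕ) (g : Polynomial F) : ℕ :=
  Nat.card {α : K // IsEFree e₁ α ∧ IsGFree F g α ∧ IsEFree e₂ (a * α ^ 2 + b * α + c)}

section NV
variable {E : Type*} [Field E]

lemma nv_coeff_prod {R : Type*} [CommRing R] {ι : Type*} (s : Finset ι) (f : ι → R[X][X]) (A : ℕ)
    (h : ∀ i ∈ s, ∀ n, ((f i).coeff n).natDegree ≤ A) :
    ∀ n, ((∏ i ∈ s, f i).coeff n).natDegree ≤ s.card * A := by
  classical
  induction s using Finset.induction_on with
  | empty =>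
    intro n
    simp only [Finset.prod_empty, coeff_one]
    split_ifs <;> simp
  | insert a s ha ih =>
    intro n
    rw [Finset.prod_insert ha, coeff_mul, Finset.card_insert_of_notMem ha]
    apply natDegree_sum_le_of_forall_le
    intro x hx
    refine natDegree_mul_le.trans ?_
    have h1 := h a (Finset.mem_insert_self _ _) x.1
    have h2 := ih (fun i hi => h i (Finset.mem_insert_of_mem hi)) x.2
    nlinarith

/-- specialisation `Y ↦ X^P` in `E[Y][X]`, is injective on small `X`-degree. -/
lemma nv_spec_inj (P : ℕ) (N : E[X][X]) (hN : N.natDegree < P)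
    (h : eval₂ (expand E P : E[X] →+* E[X]) X N = 0) : N = 0 := by
  have hP : 0 < P := by omega
  ext i m
  by_cases hi : i < P
  · have h1 : (eval₂ (expand E P : E[X] →+* E[X]) X N).coeff (i + P * m) = 0 := by rw [h]; simp
    rw [eval₂_eq_sum_range' _ hN, finsetSum_coeff] at h1
    rw [Finset.sum_eq_single i] at h1
    · rw [coeff_mul_X_pow', if_pos (by omega)] at h1
      simp only [RingHom.coe_coe] at h1
      rw [coeff_expand hP, if_pos ⟨m, by omega⟩] at h1
      rw [Nat.add_sub_cancel_left, Nat.mul_div_cancel_left _ hP] at h1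
      simpa using h1
    · intro j hj hji
      rw [coeff_mul_X_pow']
      split_ifs with hle
      · simp only [RingHom.coe_coe]
        rw [coeff_expand hP, if_neg]
        rintro ⟨t, ht⟩
        have hj' := Finset.mem_range.1 hj
        have h3 : i + P * m = j + P * t := by omega
        have h4 : (i + P * m) % P = (j + P * t) % P := by rw [h3]
        rw [Nat.add_mul_mod_self_left, Nat.add_mul_mod_self_left, Nat.mod_eq_of_lt hi,
          Nat.mod_eq_of_lt hj'] at h4
        exact hji h4.symm
      · rfl
    · intro h'
      exact absurd (Finset.mem_range.2 hi) h'
  · have : N.coeff i = 0 := coeff_eq_zero_of_natDegree_lt (by omega)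
    rw [this]; simp

/-- The norm polynomial -/
noncomputable def nvN (d : ℕ) (M : E[X][X][X]) (GX GY : E[X][X]) : E[X][X] :=
  ∑ m ∈ Finset.range d, M.coeff (d * m) * GY ^ m * GX ^ (d - 1 - m)

lemma nv_evalN {B : Type*} [CommRing B] (d : ℕ) (hd : 0 < d) (M : E[X][X][X]) (GX GY : E[X][X])
    (hM : ∀ n, ¬ d ∣ n → M.coeff n = 0) (hdeg : M.natDegree < d * d)
    (τ : E[X][X] →+* B) (s : B) (hs : s ^ d * τ GX = τ GY) :
    τ (nvN d M GX GY) = eval₂ τ s M * τ GX ^ (d - 1) := by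
  rw [eval₂_eq_sum_range' _ hdeg, nvN, map_sum, Finset.sum_mul]
  apply Finset.sum_of_injOn (fun m => d * m) (fun a _ b _ h => Nat.eq_of_mul_eq_mul_left hd h)
  · intro m hm
    have := Finset.mem_range.1 (Finset.mem_coe.1 hm)
    simp only [Finset.coe_range, Set.mem_Iio]
    exact Nat.mul_lt_mul_of_pos_left this hd
  · intro n hn hn'
    by_cases hdn : d ∣ n
    · obtain ⟨m, rfl⟩ := hdn
      refine absurd ⟨m, ?_, rfl⟩ hn'
      have := Finset.mem_range.1 hn
      simpa using Nat.lt_of_mul_lt_mul_left this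
    · rw [hM n hdn]; simp
  · intro m hm
    have hm' := Finset.mem_range.1 hm
    have h1 : d - 1 = m + (d - 1 - m) := by omega
    conv_rhs => rw [h1]
    rw [map_mul, map_mul, map_pow, map_pow, ← hs, pow_mul, mul_pow, pow_add]
    ring

lemma nv_kummer {A B : Type*} [Field A] [Field B] [Algebra A B] [IsAlgClosed B]
    (d : ℕ) (hd : 0 < d) (c : A) 
    (hc : ∀ (e : ℕ) (u : A), c ^ e = u ^ d → d ∣ e) (s : B) (hs : s ^ d = algebraMap A B c)
    (p : A[X]) (hp : p.natDegree < d) (hps : aeval s p = 0) : p = 0 := by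
  have hintg : IsIntegral A s := by
    refine ⟨X ^ d - C c, monic_X_pow_sub_C _ hd.ne', ?_⟩
    simp [hs]
  set q := minpoly A s with hq
  have hqm : q.Monic := minpoly.monic hintg
  have hdvd : q ∣ X ^ d - C c := minpoly.dvd _ _ (by simp [hs])
  have hsp : (q.map (algebraMap A B)).Splits := IsAlgClosed.splits _
  have h0 := hsp.coeff_zero_eq_prod_roots_of_monic (hqm.map _)
  have hall : ∀ r ∈ (q.map (algebraMap A B)).roots, r ^ d = algebraMap A B c := by
    intro r hr
    have h1 := (mem_roots'.1 hr).2
    have h2 : (X ^ d - C c : A[X]).map (algebraMap A B) |>.IsRoot r :=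
      h1.dvd (Polynomial.map_dvd _ hdvd)
    simpa [IsRoot, sub_eq_zero] using h2
  have hcard : (q.map (algebraMap A B)).roots.card = q.natDegree := by
    rw [← hsp.natDegree_eq_card_roots, natDegree_map]
  have h1 : ((q.map (algebraMap A B)).roots.prod) ^ d = (algebraMap A B c) ^ q.natDegree := by
    have h := Multiset.prod_map_pow (m := (q.map (algebraMap A B)).roots) (f := fun r => r) (n := d)
    rw [Multiset.map_id'] at h
    rw [← hcard, ← h, Multiset.map_congr rfl hall, Multiset.map_const',
      Multiset.prod_replicate]
  have h2 : c ^ q.natDegree = ((-1) ^ q.natDegree * q.coeff 0) ^ d := by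
    apply (algebraMap A B).injective
    rw [map_pow, ← h1, map_pow, map_mul, map_pow, map_neg, map_one]
    rw [coeff_map, natDegree_map] at h0
    rw [h0, ← mul_assoc, ← mul_pow]
    simp
  have h3 := hc _ _ h2
  have hpos : 0 < q.natDegree := minpoly.natDegree_pos hintg
  by_contra hne
  have h4 := natDegree_le_of_dvd (hq ▸ minpoly.dvd A s hps) hne
  have h5 := Nat.le_of_dvd hpos h3
  omega

/-- valuation input -/
lemma nv_val [Infinite E] (d : ℕ) (G : E[X]) (hG0 : G ≠ 0)
    (hG : ∀ e, (∀ ρ, d ∣ e * G.rootMultiplicity ρ) → d ∣ e) (e : ℕ) (s t : E[X][X]) (ht : t ≠ 0)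
    (h : (C G) ^ e * t ^ d = (G.map C) ^ e * s ^ d) : d ∣ e := by
  apply hG
  intro ρ
  have hne : t * G.map C ≠ 0 := mul_ne_zero ht (by
    rwa [Ne, Polynomial.map_eq_zero_iff (C_injective)])
  -- specialise `X`
  obtain ⟨x, hx⟩ : ∃ x : E, (t * G.map C).eval (C x) ≠ 0 := by
    by_contra hcon
    push Not at hcon
    apply hne
    refine Polynomial.eq_zero_of_infinite_isRoot _ ?_
    refine Set.Infinite.mono (s := Set.range (C : E → E[X])) ?_ (Set.infinite_range_of_injective C_injective)
    rintro _ ⟨x, rfl⟩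
    exact hcon x
  rw [eval_mul] at hx
  have h1 := congrArg (eval (C x)) h
  simp only [eval_mul, eval_pow, eval_C] at h1
  have h2 : (G.map C).eval (C x) = C (G.eval x) := by
    rw [eval_map, eval₂_at_apply]
  rw [h2] at h1 hx
  have hGx : C (G.eval x) ≠ 0 := right_ne_zero_of_mul hx
  have htx := left_ne_zero_of_mul hx
  have hl : G ^ e * (eval (C x) t) ^ d ≠ 0 := mul_ne_zero (pow_ne_zero _ hG0) (pow_ne_zero _ htx)
  have h3 := congrArg (rootMultiplicity ρ) h1
  rw [rootMultiplicity_mul hl, rootMultiplicity_mul (h1 ▸ hl), ← C_pow, rootMultiplicity_C] at h3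
  have hpow : ∀ (p : E[X]) (n : ℕ), (p ^ n).rootMultiplicity ρ = n * p.rootMultiplicity ρ := by
    classical
    intro p n
    rw [← count_roots, roots_pow, Multiset.count_nsmul, count_roots]
  rw [hpow, hpow, hpow, zero_add] at h3
  exact (Nat.dvd_add_left (Dvd.intro _ rfl)).1 (h3 ▸ Dvd.intro _ rfl)

/-- product of the conjugates -/
noncomputable def nvM {R : Type*} [CommRing R] (d : ℕ) (z : R) (Θ : R[X]) : R[X] :=
  ∏ i ∈ Finset.range d, Θ.comp (C (z ^ i) * X)

lemma nvM_comp {R : Type*} [CommRing R] (d : ℕ) (z : R) (hzd : z ^ d = 1) (Θ : R[X]) (hd : 0 < d) :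
    (nvM d z Θ).comp (C z * X) = nvM d z Θ := by
  rw [nvM, prod_comp]
  have key : ∀ i, (Θ.comp (C (z ^ i) * X)).comp (C z * X) = Θ.comp (C (z ^ (i + 1)) * X) := by
    intro i
    rw [comp_assoc, mul_comp, C_comp, X_comp, ← mul_assoc, ← C_mul, ← pow_succ]
  rw [Finset.prod_congr rfl (fun i _ => key i)]
  have h1 := Finset.prod_range_succ (fun i => Θ.comp (C (z ^ i) * X)) d
  have h2 := Finset.prod_range_succ' (fun i => Θ.comp (C (z ^ i) * X)) d
  obtain ⟨d', rfl⟩ : ∃ d', d = d' + 1 := ⟨d - 1, by omega⟩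
  rw [Finset.prod_range_succ, Finset.prod_range_succ' _ d', hzd, pow_zero]

lemma nvM_coeff {R : Type*} [CommRing R] [IsDomain R] (d : ℕ) (z : R) (hzd : z ^ d = 1)
    (hz : ∀ n, z ^ n = 1 → d ∣ n) (Θ : R[X]) (hd : 0 < d) (n : ℕ) (hn : ¬ d ∣ n) :
    (nvM d z Θ).coeff n = 0 := by
  have h1 : ((nvM d z Θ).comp (C z * X)).coeff n = (nvM d z Θ).coeff n := by
    rw [nvM_comp d z hzd Θ hd]
  rw [comp_C_mul_X_coeff] at h1
  have h2 : (nvM d z Θ).coeff n * (z ^ n - 1) = 0 := by rw [mul_sub, h1]; ring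
  rcases mul_eq_zero.1 h2 with h | h
  · exact h
  · exact absurd (hz n (sub_eq_zero.1 h)) hn

lemma nvM_natDegree {R : Type*} [CommRing R] [IsDomain R] (d : ℕ) (z : R) (Θ : R[X]) (hd : 0 < d)
    (hΘ : Θ.natDegree < d) : (nvM d z Θ).natDegree < d * d := by
  have : (nvM d z Θ).natDegree ≤ ∑ i ∈ Finset.range d, (d - 1) := by
    refine (natDegree_prod_le _ _).trans (Finset.sum_le_sum ?_)
    intro i _
    refine natDegree_comp_le.trans ?_
    have : (C (z ^ i) * X : R[X]).natDegree ≤ 1 := (natDegree_C_mul_le _ _).trans natDegree_X_le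
    calc _ ≤ Θ.natDegree * 1 := Nat.mul_le_mul_left _ this
      _ ≤ _ := by omega
  rw [Finset.sum_const, Finset.card_range, smul_eq_mul] at this
  exact this.trans_lt (Nat.mul_lt_mul_of_pos_left (by omega) hd)

lemma nvM_eval {R B : Type*} [CommRing R] [CommRing B] (d : ℕ) (z : R) (Θ : R[X])
    (τ : R →+* B) (s : B) :
    eval₂ τ s (nvM d z Θ) = ∏ i ∈ Finset.range d, eval₂ τ ((τ z) ^ i * s) Θ := by
  rw [nvM, eval₂_finsetProd]
  apply Finset.prod_congr rfl
  intro i _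
  rw [eval₂_comp, eval₂_mul, eval₂_C, eval₂_X, map_pow]

lemma nv_natDegree_CC (ζ : E) (n : ℕ) : ((C (C ζ) : E[X][X]) ^ n).natDegree = 0 := by
  rw [← C_pow, ← C_pow, natDegree_C]

lemma nv_finish (d : ℕ) (hd : 0 < d) (G : E[X]) (hG0 : G ≠ 0) [Infinite E]
    (hG : ∀ e, (∀ ρ, d ∣ e * G.rootMultiplicity ρ) → d ∣ e)
    (z : E[X][X]) (hzd : z ^ d = 1) (hz : ∀ n, z ^ n = 1 → d ∣ n)
    (Θ : E[X][X][X]) (hΘ : Θ.natDegree < d)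
    (hN0 : nvN d (nvM d z Θ) (G.map C) (C G) = 0) : Θ = 0 := by
  have hGX : (G.map C : E[X][X]) ≠ 0 := by
    rwa [Ne, Polynomial.map_eq_zero_iff (C_injective)]
  generalize hgx : (G.map C : E[X][X]) = GX at *
  generalize hgy : (C G : E[X][X]) = GY at *
  have hMc := nvM_coeff d z hzd hz Θ hd
  have hMdeg := nvM_natDegree d z Θ hd hΘ
  let L := FractionRing E[X][X]
  let B := AlgebraicClosure L
  let τ : E[X][X] →+* B := (algebraMap L B).comp (algebraMap E[X][X] L)
  have hτ : Function.Injective τ :=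
    (algebraMap L B).injective.comp (IsFractionRing.injective E[X][X] L)
  have hGXL : algebraMap E[X][X] L GX ≠ 0 := by
    rw [Ne, IsFractionRing.to_map_eq_zero_iff]; exact hGX
  set c : L := algebraMap E[X][X] L GY / algebraMap E[X][X] L GX with hc
  obtain ⟨s, hs⟩ := IsAlgClosed.exists_pow_nat_eq (algebraMap L B c) hd
  have hcs : s ^ d * τ GX = τ GY := by
    rw [hs]
    show algebraMap L B c * algebraMap L B _ = algebraMap L B _
    rw [← map_mul, hc, div_mul_cancel₀ _ hGXL]
  have h2 := nv_evalN d hd (nvM d z Θ) GX GY hMc hMdeg τ s hcs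
  rw [hN0, map_zero] at h2
  have h3 : eval₂ τ s (nvM d z Θ) = 0 := by
    rcases mul_eq_zero.1 h2.symm with h | h
    · exact h
    · exfalso
      exact hGX (hτ ((eq_zero_of_pow_eq_zero h).trans (map_zero τ).symm))
  rw [nvM_eval, Finset.prod_eq_zero_iff] at h3
  obtain ⟨i, -, hi⟩ := h3
  have h4 : Θ.map (algebraMap E[X][X] L) = 0 := by
    apply nv_kummer (B := B) d hd c _ ((τ z) ^ i * s)
    · rw [mul_pow, ← pow_mul, mul_comm i d, pow_mul, ← map_pow, hzd]; simpa using hs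
    · exact lt_of_le_of_lt natDegree_map_le hΘ
    · rw [aeval_def, eval₂_map]; exact hi
    · intro e u hu
      obtain ⟨a, b, hb, rfl⟩ := IsFractionRing.div_surjective (A := E[X][X]) u
      have hb0 := nonZeroDivisors.ne_zero hb
      have hbL : algebraMap E[X][X] L b ≠ 0 := by
        rw [Ne, IsFractionRing.to_map_eq_zero_iff]; exact hb0
      apply nv_val d G hG0 hG e a b hb0
      rw [hgx, hgy]
      apply IsFractionRing.injective E[X][X] L
      rw [hc, div_pow, div_pow, div_eq_div_iff (pow_ne_zero _ hGXL) (pow_ne_zero _ hbL)] at hu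
      simp only [map_mul, map_pow]
      rw [hu, mul_comm]
  exact (Polynomial.map_eq_zero_iff (IsFractionRing.injective E[X][X] L)).1 h4

theorem nv_main [Infinite E] (d P A : ℕ) (hd : 0 < d) (ζ : E) (hζ : IsPrimitiveRoot ζ d)
    (G : E[X]) (hG0 : G ≠ 0) (hG : ∀ e, (∀ ρ, d ∣ e * G.rootMultiplicity ρ) → d ∣ e)
    (S : E[X]) (hS : S ^ d * G = expand E P G) (Θ : E[X][X][X]) (hΘ : Θ.natDegree < d)
    (hA : ∀ n, (Θ.coeff n).natDegree ≤ A) (hP : d * A + (d - 1) * G.natDegree < P)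
    (h0 : eval₂ (eval₂RingHom (expand E P : E[X] →+* E[X]) X) S Θ = 0) : Θ = 0 := by
  set z : E[X][X] := C (C ζ) with hz
  have hzd : z ^ d = 1 := by rw [hz, ← C_pow, ← C_pow, hζ.pow_eq_one, C_1, C_1]
  have hzn : ∀ n, z ^ n = 1 → d ∣ n := by
    intro n h
    rw [← hζ.pow_eq_one_iff_dvd]
    rw [hz, ← C_pow, ← C_pow] at h
    exact C_injective (C_injective (h.trans (by rw [C_1, C_1])))
  apply nv_finish d hd G hG0 hG z hzd hzn Θ hΘ
  have hMA : ∀ n, ((nvM d z Θ).coeff n).natDegree ≤ d * A := by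
    have := nv_coeff_prod (Finset.range d) (fun i => Θ.comp (C (z ^ i) * X)) A (by
      intro i _ n
      rw [comp_C_mul_X_coeff]
      refine natDegree_mul_le.trans ?_
      rw [← pow_mul, hz, nv_natDegree_CC]
      exact hA n)
    rw [Finset.card_range] at this
    exact this
  apply nv_spec_inj P
  · refine lt_of_le_of_lt ?_ hP
    rw [nvN]
    apply natDegree_sum_le_of_forall_le
    intro m hm
    refine natDegree_mul_le.trans ?_
    refine Nat.add_le_add ?_ ?_
    · refine natDegree_mul_le.trans ?_
      rw [← C_pow, natDegree_C]
      exact hMA _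
    · refine natDegree_pow_le.trans ?_
      exact Nat.mul_le_mul (by omega) (natDegree_map_le)
  · have h1 := nv_evalN d hd (nvM d z Θ) (G.map C) (C G) (nvM_coeff d z hzd hzn Θ hd)
      (nvM_natDegree d z Θ hd hΘ)
      (eval₂RingHom (expand E P : E[X] →+* E[X]) X) S (by
        rw [coe_eval₂RingHom, eval₂_C, eval₂_map]
        have : ((expand E P : E[X] →+* E[X]).comp C) = C := by ext; simp
        rw [this, eval₂_C_X, hS]
        rfl)
    rw [nvM_eval, Finset.prod_eq_zero (Finset.mem_range.2 hd)] at h1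
    · rw [zero_mul] at h1; exact h1
    · rw [pow_zero, one_mul]; exact h0

end NV

section ST

lemma st_dep {K : Type*} [Field K] {ι : Type*} [Fintype ι] (v : ι → K[X]) (B : ℕ)
    (hv : ∀ i, (v i).natDegree < B) (hB : B < Fintype.card ι) :
    ∃ c : ι → K, ∑ i, c i • v i = 0 ∧ ∃ i, c i ≠ 0 := by
  classical
  have hmem : ∀ i, v i ∈ degreeLT K B := fun i => by
    rw [mem_degreeLT]
    exact lt_of_le_of_lt degree_le_natDegree (by exact_mod_cast hv i)
  have h : ¬ LinearIndependent K (fun i => (⟨v i, hmem i⟩ : degreeLT K B)) := by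
    intro h
    haveI : Module.Finite K (degreeLT K B) := Module.Finite.equiv (degreeLTEquiv K B).symm
    have h1 := h.fintype_card_le_finrank
    rw [(degreeLTEquiv K B).finrank_eq, Module.finrank_fin_fun] at h1
    omega
  obtain ⟨c, hc, hi⟩ := Fintype.not_linearIndependent_iff.1 h
  refine ⟨c, ?_, hi⟩
  have := congrArg (Submodule.subtype _) hc
  simpa using this

variable {K : Type*} [Field K] [Fintype K] {E : Type*} [Field E] [Algebra K E]

lemma st_frob_mem (l : ℕ) (y : K) : y ^ (Fintype.card K ^ l) = y := FiniteField.pow_card_pow _ _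

lemma st_expand (l : ℕ) (G : K[X]) : expand K (Fintype.card K ^ l) G = G ^ (Fintype.card K ^ l) := by
  induction l with
  | zero => simp
  | succ n ih =>
    rw [pow_succ, expand_mul, FiniteField.expand_card, map_pow, ih, pow_mul]

lemma st_expand' (l : ℕ) (G : K[X]) :
    expand E (Fintype.card K ^ l) (G.map (algebraMap K E)) =
      (G.map (algebraMap K E)) ^ (Fintype.card K ^ l) := by
  rw [← map_expand, st_expand, Polynomial.map_pow]

lemma st_sum_pow {ι : Type*} (s : Finset ι) (f : ι → E) (l : ℕ) :
    (∑ i ∈ s, f i) ^ (Fintype.card K ^ l) = ∑ i ∈ s, f i ^ (Fintype.card K ^ l) := by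
  obtain ⟨p, hp⟩ := CharP.exists K
  haveI := hp
  obtain ⟨n, hpr, hn⟩ := FiniteField.card K p
  haveI : Fact p.Prime := ⟨hpr⟩
  haveI : CharP E p := charP_of_injective_algebraMap (algebraMap K E).injective p
  rw [hn, ← pow_mul]
  exact sum_pow_char_pow (p := p) (n := n * l) s f

lemma st_prim : ∃ ζ : K, IsPrimitiveRoot ζ (Fintype.card K - 1) := by
  classical
  obtain ⟨u, hu⟩ := IsCyclic.exists_ofOrder_eq_natCard (α := Kˣ)
  refine ⟨(u : K), ?_⟩
  have := IsPrimitiveRoot.orderOf u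
  rw [hu, Nat.card_eq_fintype_card, Fintype.card_units] at this
  exact (IsPrimitiveRoot.coe_units_iff).2 this

/-- the auxiliary polynomial -/
noncomputable def stPsi {d J A : ℕ} (P w : ℕ) (G : K[X]) (c : Fin d × Fin J × Fin A → K) : K[X] :=
  ∑ i : Fin d × Fin J × Fin A, c i • (X ^ ((i.2.2 : ℕ) + i.2.1 * P) * G ^ ((i.1 : ℕ) * w))

noncomputable def stTheta {d J A : ℕ} (E : Type*) [Field E] [Algebra K E] (c : Fin d × Fin J × Fin A → K) : E[X][X][X] :=
  ∑ i : Fin d × Fin J × Fin A, monomial (i.1 : ℕ) (monomial (i.2.2 : ℕ)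
    (monomial (i.2.1 : ℕ) (algebraMap K E (c i))))

lemma stTheta_coeff {d J A : ℕ} (c : Fin d × Fin J × Fin A → K) (i : Fin d × Fin J × Fin A) :
    (((stTheta E c).coeff i.1).coeff i.2.2).coeff i.2.1 = algebraMap K E (c i) := by
  rw [stTheta, finsetSum_coeff, finsetSum_coeff, finsetSum_coeff, Finset.sum_eq_single i]
  · simp
  · rintro ⟨a, b, e⟩ - hne
    obtain ⟨a', b', e'⟩ := i
    simp only [coeff_monomial]
    split_ifs with h1
    · rw [coeff_monomial]
      split_ifs with h2
      · rw [coeff_monomial]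
        split_ifs with h3
        · exact absurd (by rw [Fin.ext h1, Fin.ext h2, Fin.ext h3]) hne
        · rfl
      · rfl
    · simp
  · simp

lemma stTheta_natDegree {d J A : ℕ} (hd : 0 < d) (c : Fin d × Fin J × Fin A → K) :
    (stTheta E c).natDegree < d := by
  have : (stTheta E c).natDegree ≤ d - 1 := by
    apply natDegree_sum_le_of_forall_le
    intro i _
    exact (natDegree_monomial_le _).trans (by omega)
  omega

lemma stTheta_coeff_natDegree {d J A : ℕ} (c : Fin d × Fin J × Fin A → K) (n : ℕ) :
    ((stTheta E c).coeff n).natDegree ≤ A := by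
  rw [stTheta, finsetSum_coeff]
  apply natDegree_sum_le_of_forall_le
  intro i _
  rw [coeff_monomial]
  split_ifs
  · exact (natDegree_monomial_le _).trans (by omega)
  · simp

lemma stTheta_eval {d J A : ℕ} (P w : ℕ) (G : K[X]) (c : Fin d × Fin J × Fin A → K) :
    eval₂ (eval₂RingHom (expand E P : E[X] →+* E[X]) X) ((G.map (algebraMap K E)) ^ w) (stTheta E c)
     = (stPsi P w G c).map (algebraMap K E) := by
  rw [stTheta, stPsi, eval₂_finsetSum, Polynomial.map_sum]
  apply Finset.sum_congr rfl
  intro i _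
  rw [eval₂_monomial, coe_eval₂RingHom, eval₂_monomial]
  simp only [RingHom.coe_coe, expand_monomial, Polynomial.map_smul, Polynomial.map_mul, Polynomial.map_pow, map_X]
  rw [← C_mul_X_pow_eq_monomial, smul_eq_C_mul, pow_add, pow_mul', pow_mul]
  ring

lemma stPsi_natDegree {d J A : ℕ} (P w : ℕ) (G : K[X]) (c : Fin d × Fin J × Fin A → K) :
    (stPsi P w G c).natDegree ≤ A + J * P + (d - 1) * w * G.natDegree := by
  apply natDegree_sum_le_of_forall_le
  intro i _
  refine (natDegree_smul_le _ _).trans (natDegree_mul_le.trans (Nat.add_le_add ?_ ?_))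
  · rw [natDegree_X_pow]
    exact Nat.add_le_add (by omega) (Nat.mul_le_mul_right _ (by omega))
  · refine natDegree_pow_le.trans ?_
    exact Nat.mul_le_mul_right _ (Nat.mul_le_mul_right _ (by omega))

/-- vanishing at the points. -/
lemma stPsi_zero {d J A : ℕ} (l P w : ℕ) (hP : P = Fintype.card K ^ l) (hw0 : 0 < w) (G : K[X])
    (c : Fin d × Fin J × Fin A → K) (α : K) (hα : α ≠ 0)
    (hc : ∑ i, c i • (C (α ^ (i.1 : ℕ)) * (X ^ ((i.2.2 : ℕ) * P + i.2.1) * G ^ ((d - 1 - i.1) * w))) = 0)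
    (z : E) (hz : z ^ (P * P) = z) (hzG : aeval z G ^ (w * (P + 1)) = algebraMap K E α) :
    aeval z (stPsi P w G c) = 0 := by
  set γ := aeval z G with hγ
  have hγ0 : γ ≠ 0 := by
    intro h
    rw [h, zero_pow (by positivity)] at hzG
    exact hα ((algebraMap K E).injective (by rw [← hzG, map_zero]))
  have key : γ ^ ((d - 1) * w) * (aeval z (stPsi P w G c)) ^ P = 0 := by
    have h1 := congrArg (aeval z) hc
    rw [map_zero, map_sum] at h1
    rw [← h1, stPsi, map_sum, hP, st_sum_pow, ← hP, Finset.mul_sum]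
    apply Finset.sum_congr rfl
    intro i _
    simp only [map_smul, map_mul, map_pow, aeval_X, ← hγ, aeval_C]
    simp only [Algebra.smul_def]
    rw [← hzG]
    have e1 : (d - 1) * w = (d - 1 - i.1) * w + i.1 * w := by
      rw [← add_mul]; congr 1; omega
    have e2 : (algebraMap K E (c i)) ^ P = algebraMap K E (c i) := by
      rw [← map_pow, hP, st_frob_mem]
    have e3 : (z ^ ((i.2.2 : ℕ) + i.2.1 * P)) ^ P = z ^ ((i.2.2 : ℕ) * P + i.2.1) := by
      rw [← pow_mul, add_mul, pow_add, pow_add, mul_assoc, mul_comm (i.2.1 : ℕ) (P * P),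
        pow_mul z (P * P), hz]
    rw [mul_pow, mul_pow, e2, e3, e1, pow_add]
    ring
  rcases mul_eq_zero.1 key with h | h
  · exact absurd (eq_zero_of_pow_eq_zero h) hγ0
  · exact eq_zero_of_pow_eq_zero h

theorem stepanov [IsAlgClosed E] (d D l P w : ℕ) (hd : Fintype.card K = d + 1) (hd2 : 2 ≤ d) (hP : P = Fintype.card K ^ l)
    (hw : d * w + 1 = P) (G : K[X]) (hG0 : G ≠ 0) (hD : G.natDegree = D)
    (hG : ∀ e, (∀ ρ : E, d ∣ e * (G.map (algebraMap K E)).rootMultiplicity ρ) → d ∣ e)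
    (hl : d * (D + 2) * D + (D + 2) + 1 ≤ w) (α : K) (hα : α ≠ 0) (T : Finset E)
    (hT : ∀ z ∈ T, z ^ (P * P) = z ∧ aeval z G ^ (w * (P + 1)) = algebraMap K E α) :
    d * T.card ≤ P * P + d * (2 * D + 3) * P := by
  haveI : Infinite E := IsAlgClosed.instInfinite
  have hPpos : 0 < P := by omega
  have hlw : D + 2 < w := by omega
  obtain ⟨A, hA⟩ : ∃ A, w = A + D := ⟨w - D, by omega⟩
  set J := w + (D + 2) with hJ
  have hApos : 0 < A := by omega
  obtain ⟨c, hc, i₀, hi₀⟩ := st_dep (K := K) (ι := Fin d × Fin J × Fin A)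
    (fun i => C (α ^ (i.1 : ℕ)) * (X ^ ((i.2.2 : ℕ) * P + i.2.1) * G ^ ((d - 1 - i.1) * w)))
    (A * P + J + (d - 1) * w * D) (by
      rintro ⟨a, b, e⟩
      refine lt_of_le_of_lt (natDegree_C_mul_le _ _) ?_
      refine lt_of_le_of_lt natDegree_mul_le ?_
      rw [natDegree_X_pow]
      refine Nat.add_lt_add_of_lt_of_le ?_ ?_
      · have : (e : ℕ) * P ≤ A * P := Nat.mul_le_mul_right _ (by omega)
        simp only
        omega
      · refine natDegree_pow_le.trans ?_
        rw [hD]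
        exact Nat.mul_le_mul_right _ (Nat.mul_le_mul_right _ (Nat.sub_le _ _))) (by
      simp only [Fintype.card_prod, Fintype.card_fin]
      obtain ⟨d', rfl⟩ : ∃ d', d = d' + 2 := ⟨d - 2, by omega⟩
      rw [hJ, ← hw, hA]
      rw [show d' + 2 - 1 = d' + 1 by omega]
      rw [hA] at hl
      nlinarith [Nat.zero_le (d' * A), Nat.zero_le (D * A), Nat.zero_le (d' * D), Nat.zero_le (d' * D * D)])
  have hne : stPsi P w G c ≠ 0 := by
    intro h
    obtain ⟨ζ, hζ⟩ := st_prim (K := K)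
    have hζ' : IsPrimitiveRoot (algebraMap K E ζ) d := by
      have := hζ.map_of_injective (algebraMap K E).injective
      rwa [hd, Nat.add_sub_cancel] at this
    have hΘ := nv_main d P A (by omega) _ hζ' (G.map (algebraMap K E))
      (by rwa [Ne, Polynomial.map_eq_zero]) hG ((G.map (algebraMap K E)) ^ w)
      (by rw [hP, st_expand', ← hP, ← pow_mul, ← pow_succ, mul_comm w d, hw]) (stTheta E c)
      (stTheta_natDegree (by omega) c) (stTheta_coeff_natDegree c) (by
        rw [natDegree_map, hD, ← hw, hA]
        have : (d - 1) * D ≤ d * D := Nat.mul_le_mul_right _ (by omega)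
        nlinarith) (by rw [stTheta_eval, h, Polynomial.map_zero])
    have h1 := stTheta_coeff (E := E) c i₀
    rw [hΘ] at h1
    simp only [coeff_zero] at h1
    exact hi₀ ((algebraMap K E).injective (by rw [← h1, map_zero]))
  have hroots : T.card ≤ (stPsi P w G c).natDegree := by
    classical
    rw [← natDegree_map (algebraMap K E)]
    refine le_trans (Finset.card_le_card (t := ((stPsi P w G c).map (algebraMap K E)).roots.toFinset) ?_)
      ((Multiset.toFinset_card_le _).trans (card_roots' _))
    intro z hz
    rw [Multiset.mem_toFinset, mem_roots (by rwa [Ne, Polynomial.map_eq_zero])]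
    rw [IsRoot, eval_map_algebraMap]
    exact stPsi_zero l P w hP (by omega) G c α hα hc z (hT z hz).1 (hT z hz).2
  have h2 := stPsi_natDegree P w G c
  rw [hD] at h2
  have h3 := hroots.trans h2
  have h4 : d * T.card ≤ d * (A + J * P + (d - 1) * w * D) := Nat.mul_le_mul_left _ h3
  refine h4.trans ?_
  have h5 : (d - 1) * w * D ≤ d * w * D := Nat.mul_le_mul_right _ (Nat.mul_le_mul_right _ (by omega))
  have h6 : d * w * D ≤ P * D := Nat.mul_le_mul_right _ (by omega)
  have h7 : d * (d * w * D) ≤ d * (P * D) := Nat.mul_le_mul_left _ h6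
  have h8 : d * ((d - 1) * w * D) ≤ d * (d * w * D) := Nat.mul_le_mul_left _ h5
  have h9 : d * (J * P) + P = P * P + d * (D + 2) * P := by rw [← hw, hJ]; ring
  have h10 : d * A ≤ P := by rw [← hw, hA]; nlinarith
  have h11 : 1 * P ≤ d * P := Nat.mul_le_mul_right _ (by omega)
  nlinarith

end ST

section STB
variable {K : Type*} [Field K] [Fintype K] {E : Type*} [Field E] [Algebra K E]

/-- points over the degree `k` extension -/
noncomputable def ptsZ (K : Type*) [Field K] [Fintype K] (E : Type*) [Field E] (k : ℕ) : Finset E := by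
  classical exact (X ^ (Fintype.card K ^ k) - X : E[X]).roots.toFinset

lemma mem_ptsZ {k : ℕ} (hk : k ≠ 0) {z : E} : z ∈ ptsZ K E k ↔ z ^ (Fintype.card K ^ k) = z := by
  classical
  have h1 : 1 < Fintype.card K ^ k := Nat.one_lt_pow hk Fintype.one_lt_card
  rw [ptsZ, Multiset.mem_toFinset, mem_roots (FiniteField.X_pow_card_sub_X_ne_zero E h1)]
  simp [sub_eq_zero]

lemma card_ptsZ [IsAlgClosed E] {k : ℕ} (hk : k ≠ 0) : (ptsZ K E k).card = Fintype.card K ^ k := by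
  classical
  have h1 : 1 < Fintype.card K ^ k := Nat.one_lt_pow hk Fintype.one_lt_card
  obtain ⟨p, hp⟩ := CharP.exists K
  haveI := hp
  obtain ⟨n, hpr, hn⟩ := FiniteField.card K p
  haveI : Fact p.Prime := ⟨hpr⟩
  haveI : CharP E p := charP_of_injective_algebraMap (algebraMap K E).injective p
  have hsep : (X ^ (Fintype.card K ^ k) - X : E[X]).Separable := by
    apply galois_poly_separable p
    rw [hn, ← pow_mul]
    exact dvd_pow_self _ (Nat.mul_ne_zero n.pos.ne' hk)
  rw [ptsZ, Multiset.toFinset_card_of_nodup (nodup_roots hsep),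
    ← (IsAlgClosed.splits _).natDegree_eq_card_roots, FiniteField.X_pow_card_sub_X_natDegree_eq E h1]

lemma aeval_pow_card (G : K[X]) (z : E) (k : ℕ) :
    (aeval z G) ^ (Fintype.card K ^ k) = aeval (z ^ (Fintype.card K ^ k)) G := by
  rw [← expand_aeval, st_expand, map_pow]

lemma mem_range_of_pow_card {z : E} (hz : z ^ (Fintype.card K) = z) : ∃ y : K, algebraMap K E y = z := by
  classical
  by_contra hcon
  push Not at hcon
  have h1 : 1 < Fintype.card K ^ 1 := by rw [pow_one]; exact Fintype.one_lt_card
  have hsub : insert z ((Finset.univ : Finset K).image (algebraMap K E)) ⊆ ptsZ K E 1 := by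
    intro y hy
    rw [mem_ptsZ one_ne_zero, pow_one]
    rcases Finset.mem_insert.1 hy with rfl | hy
    · exact hz
    · obtain ⟨x, -, rfl⟩ := Finset.mem_image.1 hy
      rw [← map_pow, FiniteField.pow_card]
  have hle : (ptsZ K E 1).card ≤ Fintype.card K := by
    rw [ptsZ]
    refine (Multiset.toFinset_card_le _).trans ((card_roots' _).trans ?_)
    rw [FiniteField.X_pow_card_sub_X_natDegree_eq E h1, pow_one]
  have := (Finset.card_le_card hsub).trans hle
  rw [Finset.card_insert_of_notMem, Finset.card_image_of_injective _ (algebraMap K E).injective,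
    Finset.card_univ] at this
  · omega
  · intro h
    obtain ⟨x, -, hx⟩ := Finset.mem_image.1 h
    exact hcon x hx

open Classical in
theorem stepanov_count [IsAlgClosed E] (d D l P w : ℕ) (hd : Fintype.card K = d + 1) (hd2 : 2 ≤ d)
    (hP : P = Fintype.card K ^ l)
    (hw : d * w + 1 = P) (G : K[X]) (hG0 : G ≠ 0) (hD : G.natDegree = D)
    (hG : ∀ e, (∀ ρ : E, d ∣ e * (G.map (algebraMap K E)).rootMultiplicity ρ) → d ∣ e)
    (hl : d * (D + 2) * D + (D + 2) + 1 ≤ w) :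
    |(d * ((ptsZ K E (2 * l)).filter (fun z => aeval z G ^ (w * (P + 1)) = 1)).card : ℝ) - P * P|
      ≤ d ^ 2 * (2 * D + 3) * P := by
  have hl0 : l ≠ 0 := by
    rintro rfl
    have : d * w = 0 := by simpa [hP] using hw
    rcases mul_eq_zero.1 this with h | h <;> omega
  have hl2 : 2 * l ≠ 0 := by omega
  have hPP : P * P = Fintype.card K ^ (2 * l) := by rw [hP, two_mul, pow_add]
  set Z := ptsZ K E (2 * l) with hZ
  have hZc : Z.card = P * P := by rw [hZ, card_ptsZ hl2, hPP]
  set N : K → ℕ := fun α => (Z.filter (fun z => aeval z G ^ (w * (P + 1)) = algebraMap K E α)).card with hN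
  have hup : ∀ α : K, α ≠ 0 → d * N α ≤ P * P + d * (2 * D + 3) * P := by
    intro α hα
    apply stepanov (E := E) d D l P w hd hd2 hP hw G hG0 hD hG hl α hα
    intro z hz
    rw [Finset.mem_filter, hZ, mem_ptsZ hl2, ← hPP] at hz
    exact hz
  have hcov : Z ⊆ (Z.filter (fun z => aeval z G = 0)) ∪
      ((Finset.univ : Finset K).erase 0).biUnion
        (fun α => Z.filter (fun z => aeval z G ^ (w * (P + 1)) = algebraMap K E α)) := by
    intro z hz
    rw [Finset.mem_union, Finset.mem_filter, Finset.mem_biUnion]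
    by_cases h0 : aeval z G = 0
    · exact Or.inl ⟨hz, h0⟩
    · right
      have h1 : (aeval z G) ^ (P * P) = aeval z G := by
        rw [hPP, aeval_pow_card]
        rw [hZ, mem_ptsZ hl2] at hz
        rw [hz]
      have h2 : (aeval z G ^ (w * (P + 1))) ^ (Fintype.card K) = aeval z G ^ (w * (P + 1)) := by
        have h3 : w * (P + 1) * Fintype.card K = (P * P) + (w * (P + 1) - 1) := by
          have h4 : 1 ≤ w * (P + 1) := Nat.mul_pos (by omega) (by omega)
          have h5 : P * P = d * (w * (P + 1)) + 1 := by
            calc P * P = (d * w + 1) * P := by rw [hw]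
              _ = d * w * P + P := by ring
              _ = d * w * P + (d * w + 1) := by rw [hw]
              _ = _ := by ring
          rw [hd, h5]
          generalize w * (P + 1) = t at *
          have : t * (d + 1) = d * t + t := by ring
          omega
        rw [← pow_mul, h3, pow_add, h1, ← pow_succ']
        congr 1
        have h4 : 1 ≤ w * (P + 1) := Nat.mul_pos (by omega) (by omega)
        omega
      obtain ⟨y, hy⟩ := mem_range_of_pow_card h2
      refine ⟨y, ?_, ?_⟩
      · rw [Finset.mem_erase]
        refine ⟨?_, Finset.mem_univ _⟩
        rintro rfl
        rw [map_zero] at hy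
        exact pow_ne_zero _ h0 hy.symm
      · rw [Finset.mem_filter]
        exact ⟨hz, hy.symm⟩
  have hz0 : (Z.filter (fun z => aeval z G = 0)).card ≤ D := by
    rw [← hD, ← natDegree_map (algebraMap K E)]
    refine le_trans (Finset.card_le_card (t := (G.map (algebraMap K E)).roots.toFinset) ?_)
      ((Multiset.toFinset_card_le _).trans (card_roots' _))
    intro z hz
    rw [Multiset.mem_toFinset, mem_roots (by rwa [Ne, Polynomial.map_eq_zero])]
    rw [IsRoot, eval_map_algebraMap]
    exact (Finset.mem_filter.1 hz).2
  have hsum : P * P ≤ D + ∑ α ∈ (Finset.univ : Finset K).erase 0, N α := by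
    rw [← hZc]
    refine (Finset.card_le_card hcov).trans ((Finset.card_union_le _ _).trans (Nat.add_le_add hz0 ?_))
    exact Finset.card_biUnion_le
  have hone : (1 : K) ∈ (Finset.univ : Finset K).erase 0 := by simp
  rw [← Finset.add_sum_erase _ _ hone] at hsum
  have hcardK : (((Finset.univ : Finset K).erase 0).erase 1).card = d - 1 := by
    rw [Finset.card_erase_of_mem hone, Finset.card_erase_of_mem (Finset.mem_univ _), Finset.card_univ, hd]
    simp
  have hs2 : d * ∑ α ∈ ((Finset.univ : Finset K).erase 0).erase 1, N α ≤ (d - 1) * (P * P + d * (2 * D + 3) * P) := by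
    rw [Finset.mul_sum, ← hcardK, ← smul_eq_mul (a := Finset.card _)]
    apply Finset.sum_le_card_nsmul
    intro α hα
    exact hup α (Finset.ne_of_mem_erase (Finset.mem_of_mem_erase hα))
  have h1 := hup 1 one_ne_zero
  have hN1 : (Z.filter (fun z => aeval z G ^ (w * (P + 1)) = 1)).card = N 1 := by
    rw [hN]; simp
  rw [hN1]
  have hsum' : d * (P * P) ≤ d * D + d * N 1 + (d - 1) * (P * P + d * (2 * D + 3) * P) := by
    have := Nat.mul_le_mul_left d hsum
    linarith
  obtain ⟨d', rfl⟩ : ∃ d', d = d' + 1 := ⟨d - 1, by omega⟩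
  rw [Nat.add_sub_cancel] at hsum'
  have hP1 : (1 : ℝ) ≤ P := by exact_mod_cast (by omega : 1 ≤ P)
  have hsum'' : ((d' + 1 : ℕ) : ℝ) * (P * P) ≤ (d' + 1 : ℕ) * D + (d' + 1 : ℕ) * N 1 + d' * (P * P + (d' + 1 : ℕ) * (2 * D + 3) * P) := by
    exact_mod_cast hsum'
  have h1' : ((d' + 1 : ℕ) : ℝ) * N 1 ≤ P * P + (d' + 1 : ℕ) * (2 * D + 3) * P := by exact_mod_cast h1
  push_cast at *
  rw [abs_le]
  have hD0 : (0 : ℝ) ≤ D := by positivity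
  have hd0 : (0 : ℝ) ≤ d' := by positivity
  have hDP : (D : ℝ) ≤ (2 * D + 3) * P := by nlinarith
  have hpos : (0 : ℝ) ≤ (d' + 1) * (2 * D + 3) * P := by positivity
  constructor
  · nlinarith [mul_le_mul_of_nonneg_left hDP (by linarith : (0 : ℝ) ≤ d' + 1)]
  · nlinarith [mul_nonneg hd0 hpos]

end STB

section STC
variable {K : Type*} [Field K] [Fintype K] {E : Type*} [Field E] [Algebra K E]

/-- norm exponent -/
def nexp (q k : ℕ) : ℕ := ∑ i ∈ Finset.range k, q ^ i

lemma nexp_mul (d k : ℕ) : d * nexp (d + 1) k + 1 = (d + 1) ^ k := by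
  induction k with
  | zero => simp [nexp]
  | succ n ih =>
    rw [nexp, Finset.sum_range_succ, ← nexp, pow_succ, ← ih]
    ring

lemma nexp_two_mul (q l : ℕ) : nexp q (2 * l) = nexp q l * (q ^ l + 1) := by
  rw [nexp, two_mul, Finset.sum_range_add, mul_add, mul_one, nexp, add_comm, Finset.sum_mul]
  congr 1
  apply Finset.sum_congr rfl
  intro i _
  rw [pow_add, mul_comm]

lemma le_nexp (q k : ℕ) (hq : 1 ≤ q) : k ≤ nexp q k := by
  have : ∑ i ∈ Finset.range k, 1 ≤ nexp q k := Finset.sum_le_sum (fun i _ => Nat.one_le_pow _ _ hq)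
  simpa using this

lemma rootMult_pow {E : Type*} [Field E] (ρ : E) (p : E[X]) (n : ℕ) :
    (p ^ n).rootMultiplicity ρ = n * p.rootMultiplicity ρ := by
  classical
  rw [← count_roots, roots_pow, Multiset.count_nsmul, count_roots]

/-- root multiplicities of `H(z^q - z)` -/
lemma as_mult (H : E[X]) (hH : H ≠ 0) (z : E) :
    (H.comp (X ^ Fintype.card K - X)).rootMultiplicity z = H.rootMultiplicity (z ^ Fintype.card K - z) := by
  set ρ := z ^ Fintype.card K - z with hρ
  set L : E[X] := X ^ Fintype.card K - X with hL
  obtain ⟨U, hU, hndvd⟩ := exists_eq_pow_rootMultiplicity_mul_and_not_dvd H hH ρ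
  set n := rootMultiplicity ρ H
  have hcomp : H.comp L = (L - C ρ) ^ n * U.comp L := by
    conv_lhs => rw [hU]
    simp
  have hUz : (U.comp L).eval z ≠ 0 := by
    rw [eval_comp]
    intro h
    apply hndvd
    rw [dvd_iff_isRoot]
    simpa [hL, hρ] using h
  have hUne : U.comp L ≠ 0 := by
    intro h; rw [h] at hUz; simp at hUz
  have hcard : (Fintype.card K : E) = 0 := by
    have := congrArg (algebraMap K E) (FiniteField.cast_card_eq_zero K)
    rwa [map_natCast, map_zero] at this
  have hder : (L - C ρ).derivative = -1 := by
    simp [hL, derivative_X_pow, hcard]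
  have hLne : L - C ρ ≠ 0 := by
    intro h
    rw [h] at hder
    simp at hder
  have h1 : (L - C ρ).rootMultiplicity z = 1 := by
    apply le_antisymm
    · by_contra hcon
      push Not at hcon
      have := (one_lt_rootMultiplicity_iff_isRoot hLne).1 hcon
      rw [hder] at this
      simpa using this.2
    · apply (rootMultiplicity_pos hLne).2
      simp [hL, hρ]
  rw [hcomp, rootMultiplicity_mul (mul_ne_zero (pow_ne_zero _ hLne) hUne), rootMult_pow, h1,
    rootMultiplicity_eq_zero (by exact hUz)]
  simp

lemma as_surj [IsAlgClosed E] (ρ : E) : ∃ z : E, z ^ Fintype.card K - z = ρ := by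
  have h2 : 1 < Fintype.card K := Fintype.one_lt_card
  have hdeg : (X ^ Fintype.card K - X - C ρ : E[X]).degree ≠ 0 := by
    have : (X ^ Fintype.card K - X - C ρ : E[X]) = X ^ Fintype.card K - (X + C ρ) := by ring
    rw [this, degree_sub_eq_left_of_degree_lt]
    · rw [degree_X_pow]; exact_mod_cast (by omega)
    · rw [degree_X_add_C, degree_X_pow]; exact_mod_cast h2
  obtain ⟨z, hz⟩ := IsAlgClosed.exists_root _ hdeg
  refine ⟨z, ?_⟩
  simpa [IsRoot, sub_eq_zero] using hz

lemma H_mult (ρ₁ ρ₂ : E) (hne : ρ₁ ≠ ρ₂) (a b d e : ℕ) (hab : Nat.Coprime a b)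
    (h : ∀ ρ, d ∣ e * (X ^ a * ((X - C ρ₁) * (X - C ρ₂)) ^ b : E[X]).rootMultiplicity ρ) : d ∣ e := by
  classical
  have hm : ∀ ρ, (X ^ a * ((X - C ρ₁) * (X - C ρ₂)) ^ b : E[X]).rootMultiplicity ρ
      = a * (if ρ = 0 then 1 else 0) + b * ((if ρ = ρ₁ then 1 else 0) + (if ρ = ρ₂ then 1 else 0)) := by
    intro ρ
    have hn : (X - C ρ₁) * (X - C ρ₂) ≠ 0 := mul_ne_zero (X_sub_C_ne_zero _) (X_sub_C_ne_zero _)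
    rw [rootMultiplicity_mul (mul_ne_zero (pow_ne_zero _ X_ne_zero) (pow_ne_zero _ hn)), rootMult_pow,
      rootMult_pow, rootMultiplicity_mul hn, rootMultiplicity_X_sub_C, rootMultiplicity_X_sub_C]
    congr 2
    have := rootMultiplicity_X_sub_C (x := ρ) (y := (0 : E))
    rw [C_0, sub_zero] at this
    rw [this]
  have fin : d ∣ e * a → d ∣ e * b → d ∣ e := by
    intro h1 h2
    have h3 := Nat.dvd_gcd h1 h2
    rwa [Nat.gcd_mul_left, hab.gcd_eq_one, mul_one] at h3
  have h0 := h 0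
  have h1 := h ρ₁
  have h2 := h ρ₂
  rw [hm] at h0 h1 h2
  by_cases hr1 : ρ₁ = 0
  · have hr2 : ρ₂ ≠ 0 := fun h => hne (hr1.trans h.symm)
    simp [hr2, hr2.symm, hr1] at h0 h2
    refine fin ?_ h2
    rw [mul_add] at h0
    exact (Nat.dvd_add_left h2).1 h0
  · simp [hr1, hne, Ne.symm hr1] at h0 h1
    refine fin ?_ h1
    rw [mul_add] at h0
    refine (Nat.dvd_add_left ?_).1 h0
    split_ifs
    · simpa using h1
    · simp

open Classical in
theorem count_final [IsAlgClosed E] (d : ℕ) (hd : Fintype.card K = d + 1) (hd2 : 2 ≤ d) (f : K[X])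
    (ρ₁ ρ₂ : E) (hne : ρ₁ ≠ ρ₂) (hf : f.map (algebraMap K E) = (X - C ρ₁) * (X - C ρ₂))
    (a b : ℕ) (hab : Nat.Coprime a b) : ∃ B : ℝ, ∃ l₀ : ℕ, ∀ l ≥ l₀,
    |(d * ((ptsZ K E (2 * l)).filter (fun z =>
        ((z ^ Fintype.card K - z) ^ a * (aeval (z ^ Fintype.card K - z) f) ^ b)
          ^ (nexp (Fintype.card K) (2 * l)) = 1)).card : ℝ)
      - (Fintype.card K : ℝ) ^ (2 * l)| ≤ B * (Fintype.card K : ℝ) ^ l := by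
  set H : K[X] := X ^ a * f ^ b with hH
  set G : K[X] := H.comp (X ^ Fintype.card K - X) with hG
  have hHm : H.map (algebraMap K E) = X ^ a * ((X - C ρ₁) * (X - C ρ₂)) ^ b := by
    rw [hH, Polynomial.map_mul, Polynomial.map_pow, Polynomial.map_pow, hf, map_X]
  have hHne : H.map (algebraMap K E) ≠ 0 := by
    rw [hHm]
    exact mul_ne_zero (pow_ne_zero _ X_ne_zero)
      (pow_ne_zero _ (mul_ne_zero (X_sub_C_ne_zero _) (X_sub_C_ne_zero _)))
  have hGm : G.map (algebraMap K E) = (H.map (algebraMap K E)).comp (X ^ Fintype.card K - X) := by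
    rw [hG, Polynomial.map_comp]; simp
  have hG0 : G ≠ 0 := by
    intro h
    have h1 : (H.map (algebraMap K E)).comp (X ^ Fintype.card K - X) = 0 := by
      rw [← hGm, h, Polynomial.map_zero]
    obtain ⟨ρ, hρ⟩ : ∃ ρ : E, (H.map (algebraMap K E)).eval ρ ≠ 0 := by
      haveI : Infinite E := IsAlgClosed.instInfinite
      by_contra hcon
      push Not at hcon
      exact hHne (Polynomial.funext (fun r => by rw [hcon r, eval_zero]))
    obtain ⟨z, hz⟩ := as_surj (K := K) ρ
    have h2 := congrArg (eval z) h1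
    rw [eval_comp] at h2
    simp only [eval_sub, eval_pow, eval_X, hz, eval_zero] at h2
    exact hρ h2
  have hGmult : ∀ e, (∀ ρ : E, d ∣ e * (G.map (algebraMap K E)).rootMultiplicity ρ) → d ∣ e := by
    intro e he
    apply H_mult ρ₁ ρ₂ hne a b d e hab
    intro ρ
    obtain ⟨z, hz⟩ := as_surj (K := K) ρ
    have := he z
    rw [hGm, as_mult _ hHne, hz, hHm] at this
    exact this
  refine ⟨d ^ 2 * (2 * G.natDegree + 3), d * (G.natDegree + 2) * G.natDegree + (G.natDegree + 2) + 1, ?_⟩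
  intro l hl
  have h1 : d * (G.natDegree + 2) * G.natDegree + (G.natDegree + 2) + 1 ≤ nexp (Fintype.card K) l :=
    le_trans hl (le_nexp _ _ Fintype.card_pos)
  have h2 := stepanov_count (E := E) d G.natDegree l _ (nexp (Fintype.card K) l) hd hd2 rfl
    (by rw [hd]; exact nexp_mul d l) G hG0 rfl hGmult h1
  rw [← nexp_two_mul] at h2
  have h3 : ∀ z : E, aeval z G = (z ^ Fintype.card K - z) ^ a * (aeval (z ^ Fintype.card K - z) f) ^ b := by
    intro z
    rw [hG, aeval_comp, hH]
    simp
  simp only [h3] at h2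
  rw [two_mul l, pow_add]
  push_cast at h2
  rw [← two_mul l]
  exact h2

end STC

theorem power_sum_bound {ι : Type*} [Fintype ι] (ω : ι → ℂ) (A B : ℝ) (hB : 0 < B) (l₀ : ℕ)
    (h : ∀ l ≥ l₀, ‖∑ i, ω i ^ l‖ ≤ A * B ^ l) (i : ι) : ‖ω i‖ ≤ B := by
  classical
  let c : ι → Circle := fun i => Circle.exp (Complex.arg (ω i))
  have hω : ∀ i, ω i = ‖ω i‖ * (c i : ℂ) := fun i => by
    simp only [c, Circle.coe_exp]
    exact (Complex.norm_mul_exp_arg_mul_I _).symm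
  have hcl := mapClusterPt_one_atTop_pow c
  have hev : ∀ᶠ y : ι → Circle in nhds 1, ∀ i, (1 : ℝ) / 2 < ((y i : ℂ)).re := by
    rw [Filter.eventually_all]
    intro i
    have hcont : Continuous (fun y : ι → Circle => ((y i : ℂ)).re) := by fun_prop
    have : (fun y : ι → Circle => ((y i : ℂ)).re) 1 = 1 := by simp
    apply hcont.continuousAt.eventually_const_lt
    simp only [this]; norm_num
  have hfr := hcl.frequently hev
  by_contra hcon
  push Not at hcon
  have hlt : 1 < ‖ω i‖ / B := by rwa [one_lt_div hB]
  have htend := tendsto_pow_atTop_atTop_of_one_lt hlt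
  have hev2 := (htend.eventually_gt_atTop (2 * A)).and (Filter.eventually_ge_atTop l₀)
  obtain ⟨k, hk1, hk2, hk3⟩ := (hfr.and_eventually hev2).exists
  have h1 := h k hk3
  have h2 : (1 / 2) * ‖ω i‖ ^ k ≤ ‖∑ i, ω i ^ k‖ := by
    refine le_trans ?_ (Complex.re_le_norm _)
    rw [Complex.re_sum]
    have hterm : ∀ j, (1 / 2) * ‖ω j‖ ^ k ≤ (ω j ^ k).re := by
      intro j
      have := hk1 j
      rw [hω j, mul_pow, ← Complex.ofReal_pow, Complex.re_ofReal_mul]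
      simp only [norm_mul, Circle.norm_coe, mul_one, Complex.norm_real, norm_norm]
      simp only [Pi.pow_apply, Circle.coe_pow] at this
      nlinarith [pow_nonneg (norm_nonneg (ω j)) k]
    refine le_trans (hterm i) ?_
    refine Finset.single_le_sum (f := fun j => (ω j ^ k).re) ?_ (Finset.mem_univ i)
    intro j _
    exact le_trans (by positivity) (hterm j)
  rw [div_pow, lt_div_iff₀ (pow_pos hB k)] at hk2
  linarith

section LF
variable {K : Type*} [Field K] {E : Type*} [Field E] [Algebra K E]

noncomputable def qf (B C0 : K) : K[X] := X ^ 2 + C B * X + C C0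

lemma qf_monic (B C0 : K) : (qf B C0).Monic := by
  unfold qf; monicity!

lemma qf_natDegree (B C0 : K) : (qf B C0).natDegree = 2 := by
  unfold qf; compute_degree!

noncomputable def v1 (h : K[X]) : K := (-1) ^ h.natDegree * h.coeff 0

noncomputable def v2 (B C0 : K) (h : K[X]) : K :=
  (h %ₘ qf B C0).coeff 0 ^ 2 - B * (h %ₘ qf B C0).coeff 0 * (h %ₘ qf B C0).coeff 1
    + C0 * (h %ₘ qf B C0).coeff 1 ^ 2

noncomputable def v3 (h : K[X]) : K := - h.nextCoeff

structure QSplit (B C0 : K) (ρ₁ ρ₂ : E) : Prop where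
  ne : ρ₁ ≠ ρ₂
  map : (qf B C0).map (algebraMap K E) = (X - C ρ₁) * (X - C ρ₂)

variable {B C0 : K} {ρ₁ ρ₂ : E}

lemma QSplit.sum (h : QSplit B C0 ρ₁ ρ₂) : algebraMap K E B = - (ρ₁ + ρ₂) := by
  have := congrArg (fun p => coeff p 1) h.map
  have e : (X - C ρ₁) * (X - C ρ₂) = X ^ 2 - C (ρ₁ + ρ₂) * X + C (ρ₁ * ρ₂) := by
    rw [C_add, C_mul]; ring
  rw [e] at this
  simpa [qf, coeff_X, coeff_C, coeff_X_pow] using this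

lemma QSplit.prod (h : QSplit B C0 ρ₁ ρ₂) : algebraMap K E C0 = ρ₁ * ρ₂ := by
  have := congrArg (fun p => coeff p 0) h.map
  have e : (X - C ρ₁) * (X - C ρ₂) = X ^ 2 - C (ρ₁ + ρ₂) * X + C (ρ₁ * ρ₂) := by
    rw [C_add, C_mul]; ring
  rw [e] at this
  simpa [qf, coeff_X, coeff_C, coeff_X_pow] using this

lemma QSplit.root1 (h : QSplit B C0 ρ₁ ρ₂) : aeval ρ₁ (qf B C0) = 0 := by
  rw [← eval_map_algebraMap, h.map]; simp

lemma QSplit.root2 (h : QSplit B C0 ρ₁ ρ₂) : aeval ρ₂ (qf B C0) = 0 := by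
  rw [← eval_map_algebraMap, h.map]; simp

lemma QSplit.aeval (h : QSplit B C0 ρ₁ ρ₂) (x : E) : aeval x (qf B C0) = (x - ρ₁) * (x - ρ₂) := by
  rw [← eval_map_algebraMap, h.map]; simp

lemma v2_spec (hs : QSplit B C0 ρ₁ ρ₂) (h : K[X]) :
    algebraMap K E (v2 B C0 h) = Polynomial.aeval ρ₁ h * Polynomial.aeval ρ₂ h := by
  set r := h %ₘ qf B C0 with hr
  have hrdeg : r.natDegree < 2 := by
    rw [← qf_natDegree B C0]
    apply natDegree_modByMonic_lt _ (qf_monic B C0)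
    intro h1
    have := qf_natDegree B C0
    rw [h1] at this; simp at this
  have hh : r + qf B C0 * (h /ₘ qf B C0) = h := modByMonic_add_div h (qf B C0)
  have hrx : r = C (r.coeff 1) * X + C (r.coeff 0) := by
    apply eq_X_add_C_of_natDegree_le_one; omega
  have e : ∀ ρ : E, Polynomial.aeval ρ (qf B C0) = 0 → Polynomial.aeval ρ h
      = algebraMap K E (r.coeff 1) * ρ + algebraMap K E (r.coeff 0) := by
    intro ρ hρ
    conv_lhs => rw [← hh, map_add, map_mul, hρ, zero_mul, add_zero, hrx]
    simp
  rw [e _ hs.root1, e _ hs.root2, v2, ← hr]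
  simp only [map_add, map_sub, map_mul, map_pow, hs.sum, hs.prod]
  ring

lemma v2_mul (hs : QSplit B C0 ρ₁ ρ₂) (g h : K[X]) : v2 B C0 (g * h) = v2 B C0 g * v2 B C0 h := by
  apply (algebraMap K E).injective
  rw [map_mul, v2_spec hs, v2_spec hs, v2_spec hs, map_mul, map_mul]
  ring

lemma v1_mul {g h : K[X]} (hg : g.Monic) (hh : h.Monic) : v1 (g * h) = v1 g * v1 h := by
  rw [v1, v1, v1, hg.natDegree_mul hh, mul_coeff_zero]; ring

lemma v3_mul {g h : K[X]} (hg : g.Monic) (hh : h.Monic) : v3 (g * h) = v3 g + v3 h := by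
  rw [v3, v3, v3, hg.nextCoeff_mul hh]; ring

/-- the character on monic polynomials -/
noncomputable def lam (B C0 : K) (χ₁ χ₂ : MulChar K ℂ) (ψ : AddChar K ℂ) (h : K[X]) : ℂ :=
  χ₁ (v1 h) * χ₂ (v2 B C0 h) * ψ (v3 h)

lemma lam_mul (hs : QSplit B C0 ρ₁ ρ₂) (χ₁ χ₂ : MulChar K ℂ) (ψ : AddChar K ℂ) {g h : K[X]} (hg : g.Monic)
    (hh : h.Monic) : lam B C0 χ₁ χ₂ ψ (g * h) = lam B C0 χ₁ χ₂ ψ g * lam B C0 χ₁ χ₂ ψ h := by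
  rw [lam, lam, lam, v1_mul hg hh, v2_mul hs, v3_mul hg hh, map_mul, map_mul, AddChar.map_add_eq_mul]
  ring

lemma lam_one (hs : QSplit B C0 ρ₁ ρ₂) (χ₁ χ₂ : MulChar K ℂ) (ψ : AddChar K ℂ) :
    lam B C0 χ₁ χ₂ ψ 1 = 1 := by
  have h2 : v2 B C0 1 = 1 := by
    apply (algebraMap K E).injective
    rw [v2_spec hs]; simp
  rw [lam, h2]
  simp [v1, v3, nextCoeff]

lemma monic_finite [Finite K] (n : ℕ) : {h : K[X] | h.Monic ∧ h.natDegree = n}.Finite := by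
  haveI : Finite (degreeLT K (n + 1)) := Finite.of_equiv _ (degreeLTEquiv K (n + 1)).symm.toEquiv
  refine Set.Finite.subset (Set.toFinite ((degreeLT K (n + 1) : Submodule K K[X]) : Set K[X])) ?_
  rintro h ⟨-, hn⟩
  rw [SetLike.mem_coe, mem_degreeLT]
  exact lt_of_le_of_lt degree_le_natDegree (by rw [hn]; exact_mod_cast Nat.lt_succ_self n)

variable [Finite K]

/-- monic polynomials of degree n -/
noncomputable def MM (K : Type*) [Field K] [Finite K] (n : ℕ) : Finset K[X] := (monic_finite n).toFinset

lemma mem_MM {n : ℕ} {h : K[X]} : h ∈ MM K n ↔ h.Monic ∧ h.natDegree = n := by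
  simp [MM]

noncomputable def LA (B C0 : K) (χ₁ χ₂ : MulChar K ℂ) (ψ : AddChar K ℂ) (n : ℕ) : ℂ :=
  ∑ h ∈ MM K n, lam B C0 χ₁ χ₂ ψ h

lemma LA_zero (hs : QSplit B C0 ρ₁ ρ₂) (χ₁ χ₂ : MulChar K ℂ) (ψ : AddChar K ℂ) :
    LA B C0 χ₁ χ₂ ψ 0 = 1 := by
  have : MM K 0 = {1} := by
    ext h
    rw [mem_MM, Finset.mem_singleton]
    constructor
    · rintro ⟨h1, h2⟩; exact h1.natDegree_eq_zero.1 h2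
    · rintro rfl; simp
  rw [LA, this, Finset.sum_singleton, lam_one hs]

/-- multiples -/
lemma LA_mul (hs : QSplit B C0 ρ₁ ρ₂) (χ₁ χ₂ : MulChar K ℂ) (ψ : AddChar K ℂ) {c : K[X]} (hc : c.Monic) {n k : ℕ}
    (hk : c.natDegree = k) (hkn : k ≤ n) [DecidablePred (fun h => c ∣ h)] :
    ∑ h ∈ (MM K n).filter (fun h => c ∣ h), lam B C0 χ₁ χ₂ ψ h
      = lam B C0 χ₁ χ₂ ψ c * LA B C0 χ₁ χ₂ ψ (n - k) := by
  rw [LA, Finset.mul_sum]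
  symm
  apply Finset.sum_nbij (fun h => c * h)
  · intro h hh
    rw [mem_MM] at hh
    rw [Finset.mem_filter, mem_MM, hc.natDegree_mul hh.1]
    exact ⟨⟨hc.mul hh.1, by omega⟩, dvd_mul_right _ _⟩
  · intro a _ b _ h
    exact mul_left_cancel₀ hc.ne_zero h
  · intro h hh
    rw [Finset.mem_coe, Finset.mem_filter, mem_MM] at hh
    obtain ⟨⟨h1, h2⟩, u, rfl⟩ := hh
    have hu : u.Monic := hc.of_mul_monic_left h1
    refine ⟨u, ?_, rfl⟩
    rw [Finset.mem_coe, mem_MM]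
    rw [hc.natDegree_mul hu] at h2
    exact ⟨hu, by omega⟩
  · intro h hh
    rw [mem_MM] at hh
    rw [lam_mul hs _ _ _ hc hh.1]

end LF

section LFV
variable {K : Type*} [Field K] {E : Type*} [Field E] [Algebra K E]
variable {B C0 : K} {ρ₁ ρ₂ : E}

/-- adding a low-degree poly keeps membership -/
lemma MM_add [Finite K] {n : ℕ} {h r : K[X]} (hh : h ∈ MM K n) (hr : r.degree < n) : h + r ∈ MM K n := by
  rw [mem_MM] at *
  have hd : r.degree < h.degree := by rw [degree_eq_natDegree hh.1.ne_zero, hh.2]; exact hr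
  refine ⟨hh.1.add_of_left hd, ?_⟩
  rw [natDegree_add_eq_left_of_degree_lt hd, hh.2]

lemma LA_vanish_of_map [Finite K] (χ₁ χ₂ : MulChar K ℂ) (ψ : AddChar K ℂ) (n : ℕ) (φ : K[X] → K[X])
    (hφ : ∀ h ∈ MM K n, φ h ∈ MM K n) (hinj : Set.InjOn φ (MM K n)) (t : ℂ) (ht : t ≠ 1)
    (hl : ∀ h ∈ MM K n, lam B C0 χ₁ χ₂ ψ (φ h) = t * lam B C0 χ₁ χ₂ ψ h) :
    LA B C0 χ₁ χ₂ ψ n = 0 := by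
  have h1 : LA B C0 χ₁ χ₂ ψ n = t * LA B C0 χ₁ χ₂ ψ n := by
    conv_rhs => rw [LA, Finset.mul_sum, ← Finset.sum_congr rfl hl]
    rw [LA]
    symm
    exact Finset.sum_nbij φ hφ hinj
      ((Finset.surjOn_of_injOn_of_card_le φ (by exact fun h hh => hφ h hh) hinj le_rfl)) (fun _ _ => rfl)
  have h2 : (1 - t) * LA B C0 χ₁ χ₂ ψ n = 0 := by rw [sub_mul, ← h1]; ring
  rcases mul_eq_zero.1 h2 with h | h
  · exact absurd (sub_eq_zero.1 h).symm ht
  · exact h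

lemma v2_congr (hs : QSplit B C0 ρ₁ ρ₂) {g h : K[X]} (hd : qf B C0 ∣ g - h) : v2 B C0 g = v2 B C0 h := by
  rw [v2, v2, modByMonic_eq_of_dvd_sub (qf_monic B C0) hd]

lemma LA_vanish_psi [Finite K] (hs : QSplit B C0 ρ₁ ρ₂) (χ₁ χ₂ : MulChar K ℂ) (ψ : AddChar K ℂ) (hψ : ψ ≠ 1)
    (n : ℕ) (hn : 4 ≤ n) : LA B C0 χ₁ χ₂ ψ n = 0 := by
  obtain ⟨c, hc⟩ : ∃ c, ψ c ≠ 1 := by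
    by_contra hcon
    push Not at hcon
    exact hψ (DFunLike.ext _ _ (fun x => by rw [hcon x]; simp))
  have hdeg : ∀ c' : K, (C c' * (X ^ (n - 3) * qf B C0)).natDegree ≤ n - 1 := by
    intro c'
    refine (natDegree_C_mul_le _ _).trans (natDegree_mul_le.trans ?_)
    rw [natDegree_X_pow, qf_natDegree]; omega
  have hmem : ∀ h ∈ MM K n, h + C (-c) * (X ^ (n - 3) * qf B C0) ∈ MM K n := by
    intro h hh
    apply MM_add hh
    exact lt_of_le_of_lt degree_le_natDegree (by
      have := hdeg (-c)
      exact_mod_cast (by omega : (C (-c) * (X ^ (n - 3) * qf B C0)).natDegree < n))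
  apply LA_vanish_of_map χ₁ χ₂ ψ n (fun h => h + C (-c) * (X ^ (n - 3) * qf B C0)) hmem
    (fun a _ b _ h => add_right_cancel h) (ψ c) hc
  intro h hh
  have h2 := mem_MM.1 (hmem h hh)
  have h1 := mem_MM.1 hh
  have hX : (X ^ (n - 3) * qf B C0).coeff (n - 1) = 1 := by
    have hm : (X ^ (n - 3) * qf B C0).Monic := (monic_X_pow _).mul (qf_monic _ _)
    have hdg : (X ^ (n - 3) * qf B C0).natDegree = n - 1 := by
      rw [(monic_X_pow _).natDegree_mul (qf_monic _ _), natDegree_X_pow, qf_natDegree]; omega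
    rw [← hdg]; exact hm
  have e1 : v1 (h + C (-c) * (X ^ (n - 3) * qf B C0)) = v1 h := by
    rw [v1, v1, h1.2, h2.2]
    congr 1
    rw [coeff_add, coeff_C_mul, mul_coeff_zero, coeff_X_pow, if_neg (by omega)]
    ring
  have e2 : v2 B C0 (h + C (-c) * (X ^ (n - 3) * qf B C0)) = v2 B C0 h := by
    apply v2_congr hs
    rw [add_sub_cancel_left]
    exact (dvd_mul_left _ _).mul_left _
  have e3 : v3 (h + C (-c) * (X ^ (n - 3) * qf B C0)) = v3 h + c := by
    rw [v3, v3, nextCoeff_of_natDegree_pos (by omega), nextCoeff_of_natDegree_pos (by omega), h1.2, h2.2,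
      coeff_add, coeff_C_mul, hX]
    ring
  show lam _ _ _ _ _ _ = _
  rw [lam, lam, e1, e2, e3, AddChar.map_add_eq_mul]
  ring

lemma coprime_of_vals (hs : QSplit B C0 ρ₁ ρ₂) (t : K[X]) (h0 : t.coeff 0 ≠ 0) (h2 : v2 B C0 t ≠ 0) :
    IsCoprime t (X * qf B C0) := by
  have h2' : Polynomial.aeval ρ₁ t * Polynomial.aeval ρ₂ t ≠ 0 := by
    rw [← v2_spec hs]
    rwa [Ne, map_eq_zero_iff _ (algebraMap K E).injective]
  have key : ∀ (ρ : E), Polynomial.aeval ρ t ≠ 0 → IsCoprime (t.map (algebraMap K E)) (X - C ρ) := by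
    intro ρ hρ
    rw [isCoprime_comm, (irreducible_X_sub_C ρ).coprime_iff_not_dvd, dvd_iff_isRoot, IsRoot,
      eval_map_algebraMap]
    exact hρ
  apply IsCoprime.mul_right
  · rw [isCoprime_comm, irreducible_X.coprime_iff_not_dvd, X_dvd_iff]
    exact h0
  · rw [← isCoprime_map (algebraMap K E), hs.map]
    exact (key _ (left_ne_zero_of_mul h2')).mul_right (key _ (right_ne_zero_of_mul h2'))

lemma LA_vanish_chi [Finite K] (hs : QSplit B C0 ρ₁ ρ₂) (χ₁ χ₂ : MulChar K ℂ) (t : K[X])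
    (h0 : t.coeff 0 ≠ 0) (h2 : v2 B C0 t ≠ 0) (hne : χ₁ (t.coeff 0) * χ₂ (v2 B C0 t) ≠ 1)
    (n : ℕ) (hn : 4 ≤ n) : LA B C0 χ₁ χ₂ (1 : AddChar K ℂ) n = 0 := by
  have hcop := coprime_of_vals hs t h0 h2
  set m := X * qf B C0 with hm
  have hmm : m.Monic := monic_X.mul (qf_monic _ _)
  have hmd : m.natDegree = 3 := by
    rw [hm, monic_X.natDegree_mul (qf_monic _ _), natDegree_X, qf_natDegree]
  have hmem : ∀ h ∈ MM K n, h + ((t - 1) * h) %ₘ m ∈ MM K n := by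
    intro h hh
    apply MM_add hh
    refine lt_of_lt_of_le (degree_modByMonic_lt _ hmm) ?_
    rw [degree_eq_natDegree hmm.ne_zero, hmd]
    exact_mod_cast (by omega)
  have hcong : ∀ h, m ∣ (h + ((t - 1) * h) %ₘ m) - t * h := by
    intro h
    have := modByMonic_add_div ((t - 1) * h) m
    refine ⟨-(((t - 1) * h) /ₘ m), ?_⟩
    linear_combination this
  apply LA_vanish_of_map χ₁ χ₂ 1 n (fun h => h + ((t - 1) * h) %ₘ m) hmem ?_ _ hne
  · intro h hh
    have h2 := mem_MM.1 (hmem h hh)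
    have h1 := mem_MM.1 hh
    obtain ⟨u, hu⟩ := hcong h
    have e0 : h + ((t - 1) * h) %ₘ m = t * h + m * u := by rw [← hu]; ring
    have e1 : v1 (h + ((t - 1) * h) %ₘ m) = t.coeff 0 * v1 h := by
      rw [v1, v1, h1.2, h2.2, e0, coeff_add, mul_coeff_zero, mul_coeff_zero, hm, mul_coeff_zero]
      simp only [coeff_X_zero]
      ring
    have e2 : v2 B C0 (h + ((t - 1) * h) %ₘ m) = v2 B C0 t * v2 B C0 h := by
      rw [← v2_mul hs]
      apply v2_congr hs
      exact (dvd_mul_left _ _).trans (hcong h)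
    show lam _ _ _ _ _ _ = _
    rw [lam, lam, e1, e2, map_mul, map_mul]
    simp only [AddChar.one_apply]
    ring
  · intro a ha b hb hab
    simp only at hab
    have h1 : m ∣ t * (a - b) := by
      have := dvd_sub (hcong b) (hcong a)
      rw [hab] at this
      convert this using 1
      ring
    have h2 : m ∣ a - b := hcop.symm.dvd_of_dvd_mul_left h1
    have h3 : ((t - 1) * a) %ₘ m = ((t - 1) * b) %ₘ m := by
      apply modByMonic_eq_of_dvd_sub hmm
      rw [← mul_sub]
      exact h2.mul_left _
    rw [h3] at hab
    exact add_right_cancel hab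

lemma v2_lin (hs : QSplit B C0 ρ₁ ρ₂) (u v : K) (w : K[X]) :
    v2 B C0 (C u + C v * X + w * qf B C0) = u ^ 2 - B * u * v + C0 * v ^ 2 := by
  apply (algebraMap K E).injective
  rw [v2_spec hs]
  simp only [map_add, map_mul, hs.root1, hs.root2, map_sub, map_pow, aeval_C, aeval_X, hs.sum, hs.prod]
  ring

lemma exists_chi_ne {χ : MulChar K ℂ} (h : χ ≠ 1) : ∃ s : K, s ≠ 0 ∧ χ s ≠ 1 := by
  obtain ⟨a, ha⟩ := MulChar.ne_one_iff.1 h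
  exact ⟨a, a.ne_zero, ha⟩

lemma exists_norm [Fintype K] (hodd : Fintype.card K % 2 = 1) (B C0 s : K) (hD : B ^ 2 - 4 * C0 ≠ 0) :
    ∃ u v : K, u ^ 2 - B * u * v + C0 * v ^ 2 = s := by
  have h2 : (2 : K) ≠ 0 := by
    apply Ring.two_ne_zero
    intro h
    have := FiniteField.even_card_iff_char_two.1 h
    omega
  have hA : -(B ^ 2 - 4 * C0) / 4 ≠ 0 := by
    apply div_ne_zero (neg_ne_zero.2 hD)
    rw [show (4 : K) = 2 * 2 by norm_num]
    exact mul_ne_zero h2 h2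
  obtain ⟨a, b, hab⟩ := FiniteField.exists_root_sum_quadratic (R := K)
    (f := C 1 * X ^ 2 + C 0 * X + C 0) (g := C (-(B ^ 2 - 4 * C0) / 4) * X ^ 2 + C 0 * X + C (-s))
    (degree_quadratic one_ne_zero) (degree_quadratic hA) hodd
  refine ⟨a + B * b / 2, b, ?_⟩
  simp at hab
  have h4 : (4 : K) ≠ 0 := by
    rw [show (4 : K) = 2 * 2 by norm_num]
    exact mul_ne_zero h2 h2
  field_simp
  field_simp at hab
  linear_combination hab

theorem LA_vanish [Fintype K] (hodd : Fintype.card K % 2 = 1) (hs : QSplit B C0 ρ₁ ρ₂)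
    (χ₁ χ₂ : MulChar K ℂ) (ψ : AddChar K ℂ)
    (hnt : ¬ (χ₁ = 1 ∧ χ₂ = 1 ∧ ψ = 1)) (n : ℕ) (hn : 4 ≤ n) : LA B C0 χ₁ χ₂ ψ n = 0 := by
  by_cases hψ : ψ = 1
  swap
  · exact LA_vanish_psi hs χ₁ χ₂ ψ hψ n hn
  subst hψ
  have hD : B ^ 2 - 4 * C0 ≠ 0 := by
    intro h
    have h1 := congrArg (algebraMap K E) h
    simp only [map_sub, map_pow, map_mul, hs.sum, hs.prod, map_zero, map_ofNat] at h1
    have : (ρ₁ - ρ₂) ^ 2 = 0 := by linear_combination h1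
    exact hs.ne (sub_eq_zero.1 (pow_eq_zero_iff (two_ne_zero) |>.1 this))
  have fin : ∀ t : K[X], ∀ a b : K, t.coeff 0 = a → v2 B C0 t = b → a ≠ 0 → b ≠ 0 → χ₁ a * χ₂ b ≠ 1 →
      LA B C0 χ₁ χ₂ (1 : AddChar K ℂ) n = 0 := by
    rintro t a b rfl rfl h1 h2 h3
    exact LA_vanish_chi hs χ₁ χ₂ t h1 h2 h3 n hn
  have hq0 : (qf B C0).coeff 0 = C0 := by simp [qf]
  by_cases hC : C0 = 0
  · have hB : B ≠ 0 := by
      rintro rfl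
      apply hD
      rw [hC]; ring
    by_cases hχ2 : χ₂ = 1
    · have hχ1 : χ₁ ≠ 1 := fun h => hnt ⟨h, hχ2, rfl⟩
      obtain ⟨s, hs0, hs1⟩ := exists_chi_ne hχ1
      refine fin (C s + C 0 * X + 0 * qf B C0) s (s ^ 2) (by simp) ?_ hs0 (pow_ne_zero _ hs0) ?_
      · rw [v2_lin hs]; ring
      · rw [hχ2, MulChar.one_apply (pow_ne_zero _ hs0).isUnit, mul_one]; exact hs1
    · obtain ⟨s, hs0, hs1⟩ := exists_chi_ne hχ2
      refine fin (C 1 + C ((1 - s) / B) * X + 0 * qf B C0) 1 s (by simp) ?_ one_ne_zero hs0 ?_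
      · rw [v2_lin hs, hC]; field_simp; ring
      · rw [map_one, one_mul]; exact hs1
  · by_cases hχ2 : χ₂ = 1
    · have hχ1 : χ₁ ≠ 1 := fun h => hnt ⟨h, hχ2, rfl⟩
      obtain ⟨s, hs0, hs1⟩ := exists_chi_ne hχ1
      refine fin (C 1 + C 0 * X + C ((s - 1) / C0) * qf B C0) s 1 ?_ ?_ hs0 one_ne_zero ?_
      · simp [hq0]; field_simp; ring
      · rw [v2_lin hs]; ring
      · rw [map_one, mul_one]; exact hs1
    · obtain ⟨s, hs0, hs1⟩ := exists_chi_ne hχ2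
      obtain ⟨u, v, huv⟩ := exists_norm hodd B C0 s hD
      refine fin (C u + C v * X + C ((1 - u) / C0) * qf B C0) 1 s ?_ ?_ one_ne_zero hs0 ?_
      · simp [hq0]; field_simp; ring
      · rw [v2_lin hs, huv]
      · rw [map_one, one_mul]; exact hs1

end LFV

section NW
variable {K : Type*} [Field K] [Fintype K] {E : Type*} [Field E] [Algebra K E]

lemma sub_pow_card_pow (K : Type*) [Field K] [Fintype K] {E : Type*} [Field E] [Algebra K E] (y z : E) (l : ℕ) :
    (y - z) ^ (Fintype.card K ^ l) = y ^ (Fintype.card K ^ l) - z ^ (Fintype.card K ^ l) := by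
  obtain ⟨p, hp⟩ := CharP.exists K
  haveI := hp
  obtain ⟨n, hpr, hn⟩ := FiniteField.card K p
  haveI : Fact p.Prime := ⟨hpr⟩
  haveI : CharP E p := charP_of_injective_algebraMap (algebraMap K E).injective p
  rw [hn, ← pow_mul]
  exact sub_pow_char_pow (p := p) (n := n * l) y z

lemma pow_card_inj (K : Type*) [Field K] [Fintype K] {E : Type*} [Field E] [Algebra K E] {y z : E} {l : ℕ}
    (h : y ^ (Fintype.card K ^ l) = z ^ (Fintype.card K ^ l)) : y = z := by
  rw [← sub_eq_zero, ← sub_pow_card_pow] at h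
  exact sub_eq_zero.1 (eq_zero_of_pow_eq_zero h)

lemma isIntegral_of_mem {k : ℕ} (hk : k ≠ 0) {x : E} (hx : x ∈ ptsZ K E k) : IsIntegral K x := by
  rw [mem_ptsZ hk] at hx
  refine ⟨X ^ (Fintype.card K ^ k) - X, ?_, by simp [hx]⟩
  exact monic_X_pow_sub (by rw [degree_X]; exact_mod_cast Nat.one_lt_pow hk Fintype.one_lt_card)

lemma mem_ptsZ_iff {k : ℕ} (hk : k ≠ 0) {x : E} (hx : IsIntegral K x) :
    x ∈ ptsZ K E k ↔ (minpoly K x).natDegree ∣ k := by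
  rw [mem_ptsZ hk, (minpoly.irreducible hx).natDegree_dvd_iff_dvd_X_pow_card_pow_sub_X,
    minpoly.dvd_iff]
  simp [sub_eq_zero, Nat.card_eq_fintype_card]

lemma minpoly_pow_dvd_iff {x : E} (hx : IsIntegral K x) {h : K[X]} (hh : h ≠ 0) (j : ℕ) :
    (minpoly K x) ^ j ∣ h ↔ j ≤ (h.map (algebraMap K E)).rootMultiplicity x := by
  have hirr := minpoly.irreducible hx
  have hmap : h.map (algebraMap K E) ≠ 0 := by rwa [Ne, Polynomial.map_eq_zero]
  have hroot : ((minpoly K x).map (algebraMap K E)).IsRoot x := by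
    rw [IsRoot, eval_map_algebraMap, minpoly.aeval]
  have hmm : (minpoly K x).map (algebraMap K E) ≠ 0 := by
    rw [Ne, Polynomial.map_eq_zero]; exact hirr.ne_zero
  have h1 : ((minpoly K x).map (algebraMap K E)).rootMultiplicity x = 1 := by
    apply le_antisymm
    · exact rootMultiplicity_le_one_of_separable (Separable.map (PerfectField.separable_of_irreducible hirr)) x
    · exact (rootMultiplicity_pos hmm).2 hroot
  constructor
  · rintro ⟨u, rfl⟩
    rw [Polynomial.map_mul, Polynomial.map_pow] at hmap ⊢
    rw [rootMultiplicity_mul hmap, rootMult_pow, h1]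
    omega
  · obtain ⟨u, hu, hhu⟩ := (FiniteMultiplicity.of_prime_left hirr.prime hh).exists_eq_pow_mul_and_not_dvd
    set i := multiplicity (minpoly K x) h
    intro hj
    have h2 : (h.map (algebraMap K E)).rootMultiplicity x = i := by
      rw [hu, Polynomial.map_mul, Polynomial.map_pow] at hmap ⊢
      rw [rootMultiplicity_mul hmap, rootMult_pow, h1, rootMultiplicity_eq_zero]
      · omega
      · rw [IsRoot, eval_map_algebraMap]
        intro h
        exact hhu (minpoly.dvd K x h)
    rw [h2] at hj
    rw [hu]
    exact (pow_dvd_pow _ hj).mul_right _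

/-- characteristic polynomial of a point -/
noncomputable def cpt (K : Type*) [Field K] {E : Type*} [Field E] [Algebra K E] (x : E) (k : ℕ) : K[X] :=
  (minpoly K x) ^ (k / (minpoly K x).natDegree)

lemma cpt_monic {k : ℕ} (hk : k ≠ 0) {x : E} (hx : x ∈ ptsZ K E k) : (cpt K x k).Monic :=
  (minpoly.monic (isIntegral_of_mem hk hx)).pow _

lemma cpt_natDegree {k : ℕ} (hk : k ≠ 0) {x : E} (hx : x ∈ ptsZ K E k) : (cpt K x k).natDegree = k := by
  rw [cpt, natDegree_pow]
  exact Nat.div_mul_cancel ((mem_ptsZ_iff hk (isIntegral_of_mem hk hx)).1 hx)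

lemma minpoly_map_eq {x : E} (hx : IsIntegral K x) :
    (minpoly K x).map (algebraMap K E)
      = ∏ i ∈ Finset.range (minpoly K x).natDegree, (X - C (x ^ (Fintype.card K ^ i))) := by
  set δ := (minpoly K x).natDegree with hδ
  have hinj : Function.Injective (fun i : Fin δ => x ^ (Fintype.card K ^ (i : ℕ))) := by
    have key : ∀ i j : ℕ, i < j → j < δ → x ^ (Fintype.card K ^ i) ≠ x ^ (Fintype.card K ^ j) := by
      intro i j hij hj h
      have h1 : x = x ^ (Fintype.card K ^ (j - i)) := by
        apply pow_card_inj K (l := i)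
        rw [h, ← pow_mul, ← pow_add]
        congr 2; omega
      have h2 := (mem_ptsZ_iff (K := K) (by omega : j - i ≠ 0) hx).1 ((mem_ptsZ (by omega)).2 h1.symm)
      have := Nat.le_of_dvd (by omega) h2
      omega
    intro i j h
    rcases lt_trichotomy (i : ℕ) j with hlt | heq | hlt
    · exact absurd h (key _ _ hlt j.2)
    · exact Fin.ext heq
    · exact absurd h.symm (key _ _ hlt i.2)
  have hdvd : ∏ i ∈ Finset.range δ, (X - C (x ^ (Fintype.card K ^ i))) ∣ (minpoly K x).map (algebraMap K E) := by
    rw [← Fin.prod_univ_eq_prod_range (fun i => X - C (x ^ (Fintype.card K ^ i)))]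
    apply Finset.prod_dvd_of_coprime
    · intro i _ j _ hij
      exact pairwise_coprime_X_sub_C hinj hij
    · intro i _
      rw [dvd_iff_isRoot, IsRoot, eval_map_algebraMap, ← aeval_pow_card, minpoly.aeval, zero_pow]
      exact pow_ne_zero _ Fintype.card_ne_zero
  have hm : (∏ i ∈ Finset.range δ, (X - C (x ^ (Fintype.card K ^ i)))).Monic :=
    monic_prod_of_monic _ (fun i => X - C (x ^ (Fintype.card K ^ i))) (fun i _ => monic_X_sub_C _)
  have hdeg : (∏ i ∈ Finset.range δ, (X - C (x ^ (Fintype.card K ^ i)))).natDegree = δ := by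
    rw [natDegree_prod_of_monic _ (fun i => X - C (x ^ (Fintype.card K ^ i))) (fun i _ => monic_X_sub_C _)]
    simp only [natDegree_X_sub_C, Finset.sum_const, Finset.card_range, smul_eq_mul, mul_one]
  exact eq_of_monic_of_dvd_of_natDegree_le hm ((minpoly.monic hx).map _) hdvd
    (by rw [natDegree_map, hdeg])

lemma cpt_map {k : ℕ} (hk : k ≠ 0) {x : E} (hx : x ∈ ptsZ K E k) :
    (cpt K x k).map (algebraMap K E) = ∏ i ∈ Finset.range k, (X - C (x ^ (Fintype.card K ^ i))) := by
  have hintg := isIntegral_of_mem hk hx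
  have hdvd := (mem_ptsZ_iff hk hintg).1 hx
  set δ := (minpoly K x).natDegree with hδ
  have hpos : δ ≠ 0 := (minpoly.natDegree_pos hintg).ne'
  have hper : x ^ (Fintype.card K ^ δ) = x := (mem_ptsZ hpos).1 ((mem_ptsZ_iff hpos hintg).2 dvd_rfl)
  have hper2 : ∀ j, x ^ (Fintype.card K ^ (δ * j)) = x := by
    intro j
    induction j with
    | zero => simp
    | succ n ih => rw [Nat.mul_succ, pow_add, pow_mul, ih, hper]
  have key : ∀ j, ((minpoly K x) ^ j).map (algebraMap K E)
      = ∏ i ∈ Finset.range (δ * j), (X - C (x ^ (Fintype.card K ^ i))) := by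
    intro j
    induction j with
    | zero => simp
    | succ n ih =>
      rw [Nat.mul_succ, Finset.prod_range_add, pow_succ, Polynomial.map_mul, ih, minpoly_map_eq hintg]
      congr 1
      apply Finset.prod_congr rfl
      intro i _
      rw [pow_add, pow_mul, hper2]
  rw [cpt, key, Nat.mul_div_cancel' hdvd]

open Classical in
lemma count_mult [IsAlgClosed E] {n : ℕ} {h : K[X]} (hh : h.Monic) (hn : h.natDegree = n) :
    ∑ k ∈ Finset.Icc 1 n, ((ptsZ K E k).filter (fun x => cpt K x k ∣ h)).card = n := by
  have hh0 := hh.ne_zero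
  set R := (h.map (algebraMap K E)).roots with hR
  have hcardR : R.card = n := by
    rw [hR, ← (IsAlgClosed.splits _).natDegree_eq_card_roots, natDegree_map, hn]
  have h1 : ∀ k ∈ Finset.Icc 1 n, ((ptsZ K E k).filter (fun x => cpt K x k ∣ h)).card
      = ∑ x ∈ R.toFinset, if (x ∈ ptsZ K E k ∧ cpt K x k ∣ h) then 1 else 0 := by
    intro k hk
    have hk0 : k ≠ 0 := by have := (Finset.mem_Icc.1 hk).1; omega
    rw [← Finset.card_filter]
    congr 1
    ext x
    simp only [Finset.mem_filter, Multiset.mem_toFinset]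
    refine ⟨fun hx => ⟨?_, hx⟩, fun hx => hx.2⟩
    rw [hR, mem_roots (by rw [Ne, Polynomial.map_eq_zero]; exact hh0), IsRoot, eval_map_algebraMap]
    obtain ⟨u, hu⟩ := hx.2
    rw [hu, map_mul, ← eval_map_algebraMap, cpt_map hk0 hx.1, eval_prod]
    rw [Finset.prod_eq_zero (Finset.mem_range.2 (Nat.pos_of_ne_zero hk0))]
    · ring
    · simp
  rw [Finset.sum_congr rfl h1, Finset.sum_comm]
  have h2 : ∀ x ∈ R.toFinset, (∑ k ∈ Finset.Icc 1 n, if (x ∈ ptsZ K E k ∧ cpt K x k ∣ h) then 1 else 0)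
      = R.count x := by
    intro x hx
    rw [Multiset.mem_toFinset, hR, mem_roots (by rw [Ne, Polynomial.map_eq_zero]; exact hh0), IsRoot,
      eval_map_algebraMap] at hx
    have hintg : IsIntegral K x := ⟨h, hh, hx⟩
    have hpos : 0 < (minpoly K x).natDegree := minpoly.natDegree_pos hintg
    rw [← Finset.card_filter, hR, count_roots]
    set μ := rootMultiplicity x (h.map (algebraMap K E)) with hμ
    have : (Finset.Icc 1 μ).card = μ := by simp
    rw [← this]
    symm
    apply Finset.card_nbij (fun j => (minpoly K x).natDegree * j)
    · intro j hj
      have hj' := Finset.mem_Icc.1 hj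
      have hd := (minpoly_pow_dvd_iff hintg hh0 j).2 hj'.2
      rw [Finset.mem_coe, Finset.mem_filter, Finset.mem_Icc]
      have hle := natDegree_le_of_dvd hd hh0
      rw [natDegree_pow, hn, mul_comm] at hle
      have hne : (minpoly K x).natDegree * j ≠ 0 := Nat.mul_ne_zero hpos.ne' (by omega)
      refine ⟨⟨Nat.pos_of_ne_zero hne, hle⟩, (mem_ptsZ_iff hne hintg).2 (dvd_mul_right _ _), ?_⟩
      rw [cpt, Nat.mul_div_cancel_left _ hpos]
      exact hd
    · intro a _ b _ hab
      exact Nat.eq_of_mul_eq_mul_left hpos hab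
    · intro k hk
      rw [Finset.mem_coe, Finset.mem_filter, Finset.mem_Icc] at hk
      obtain ⟨⟨hk1, hk2⟩, hk3, hk4⟩ := hk
      have hdvd := (mem_ptsZ_iff (by omega) hintg).1 hk3
      obtain ⟨j, rfl⟩ := hdvd
      rw [cpt, Nat.mul_div_cancel_left _ hpos, minpoly_pow_dvd_iff hintg hh0] at hk4
      refine ⟨j, ?_, rfl⟩
      rw [Finset.mem_coe, Finset.mem_Icc]
      refine ⟨?_, hk4⟩
      rcases Nat.eq_zero_or_pos j with rfl | hj
      · simp at hk1
      · exact hj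
  rw [Finset.sum_congr rfl h2, Multiset.toFinset_sum_count_eq, hcardR]

variable {B C0 : K} {ρ₁ ρ₂ : E}

/-- the sum over points of degree `k` -/
noncomputable def LS (E : Type*) [Field E] [Algebra K E] (B C0 : K) (χ₁ χ₂ : MulChar K ℂ) (ψ : AddChar K ℂ) (k : ℕ) : ℂ :=
  ∑ x ∈ ptsZ K E k, lam B C0 χ₁ χ₂ ψ (cpt K x k)

theorem LA_newton [IsAlgClosed E] (hs : QSplit B C0 ρ₁ ρ₂) (χ₁ χ₂ : MulChar K ℂ) (ψ : AddChar K ℂ) (n : ℕ) :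
    (n : ℂ) * LA B C0 χ₁ χ₂ ψ n
      = ∑ k ∈ Finset.Icc 1 n, LS E B C0 χ₁ χ₂ ψ k * LA B C0 χ₁ χ₂ ψ (n - k) := by
  classical
  have h1 : ∀ h ∈ MM K n, (n : ℂ) * lam B C0 χ₁ χ₂ ψ h
      = ∑ k ∈ Finset.Icc 1 n, ∑ x ∈ ptsZ K E k, if cpt K x k ∣ h then lam B C0 χ₁ χ₂ ψ h else 0 := by
    intro h hh
    rw [mem_MM] at hh
    have := count_mult (E := E) hh.1 hh.2
    conv_lhs => rw [← this]
    push_cast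
    rw [Finset.sum_mul]
    apply Finset.sum_congr rfl
    intro k _
    rw [← Finset.sum_filter, Finset.sum_const, nsmul_eq_mul]
  rw [LA, Finset.mul_sum, Finset.sum_congr rfl h1, Finset.sum_comm]
  apply Finset.sum_congr rfl
  intro k hk
  have hk' := Finset.mem_Icc.1 hk
  rw [Finset.sum_comm, LS, Finset.sum_mul]
  apply Finset.sum_congr rfl
  intro x hx
  rw [← Finset.sum_filter, LA_mul hs _ _ _ (cpt_monic (by omega) hx) (cpt_natDegree (by omega) hx) hk'.2]

end NW

section VAL
variable {K : Type*} [Field K] [Fintype K] {E : Type*} [Field E] [Algebra K E]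
variable {B C0 : K} {ρ₁ ρ₂ : E}

lemma v1_cpt {k : ℕ} (hk : k ≠ 0) {x : E} (hx : x ∈ ptsZ K E k) :
    algebraMap K E (v1 (cpt K x k)) = x ^ nexp (Fintype.card K) k := by
  rw [v1, cpt_natDegree hk hx, map_mul, map_pow, map_neg, map_one, ← coeff_map, cpt_map hk hx,
    coeff_zero_eq_eval_zero, eval_prod]
  simp only [eval_sub, eval_X, eval_C, zero_sub]
  rw [nexp, ← Finset.prod_pow_eq_pow_sum]
  conv_lhs => rw [← Finset.card_range k, ← Finset.prod_const, Finset.card_range]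
  rw [← Finset.prod_mul_distrib]
  apply Finset.prod_congr rfl
  intro i _
  ring

lemma v2_cpt (hs : QSplit B C0 ρ₁ ρ₂) {k : ℕ} (hk : k ≠ 0) {x : E} (hx : x ∈ ptsZ K E k) :
    algebraMap K E (v2 B C0 (cpt K x k)) = (Polynomial.aeval x (qf B C0)) ^ nexp (Fintype.card K) k := by
  rw [v2_spec hs, ← eval_map_algebraMap, ← eval_map_algebraMap, cpt_map hk hx, eval_prod, eval_prod,
    ← Finset.prod_mul_distrib, nexp, ← Finset.prod_pow_eq_pow_sum]
  apply Finset.prod_congr rfl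
  intro i _
  rw [aeval_pow_card, hs.aeval]
  simp only [eval_sub, eval_X, eval_C]
  ring

lemma v3_cpt {k : ℕ} (hk : k ≠ 0) {x : E} (hx : x ∈ ptsZ K E k) :
    algebraMap K E (v3 (cpt K x k)) = ∑ i ∈ Finset.range k, x ^ (Fintype.card K ^ i) := by
  rw [v3, map_neg, ← nextCoeff_map (algebraMap K E).injective, cpt_map hk hx,
    prod_X_sub_C_nextCoeff]
  ring

lemma LS_one [IsAlgClosed E] (hs : QSplit B C0 ρ₁ ρ₂) (χ₁ χ₂ : MulChar K ℂ) (ψ : AddChar K ℂ) :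
    LS E B C0 χ₁ χ₂ ψ 1 = ∑ x : K, χ₁ x * χ₂ (x ^ 2 + B * x + C0) * ψ x := by
  rw [LS]
  symm
  apply Finset.sum_bij (fun x _ => algebraMap K E x)
  · intro x _
    rw [mem_ptsZ one_ne_zero, pow_one, ← map_pow, FiniteField.pow_card]
  · intro a _ b _ h
    exact (algebraMap K E).injective h
  · intro z hz
    rw [mem_ptsZ one_ne_zero, pow_one] at hz
    obtain ⟨y, hy⟩ := mem_range_of_pow_card hz
    exact ⟨y, Finset.mem_univ _, hy⟩
  · intro x _
    have hx : algebraMap K E x ∈ ptsZ K E 1 := by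
      rw [mem_ptsZ one_ne_zero, pow_one, ← map_pow, FiniteField.pow_card]
    have e1 : v1 (cpt K (algebraMap K E x) 1) = x := by
      apply (algebraMap K E).injective
      rw [v1_cpt one_ne_zero hx]; simp [nexp]
    have e2 : v2 B C0 (cpt K (algebraMap K E x) 1) = x ^ 2 + B * x + C0 := by
      apply (algebraMap K E).injective
      rw [v2_cpt hs one_ne_zero hx]; simp [nexp, qf]
    have e3 : v3 (cpt K (algebraMap K E x) 1) = x := by
      apply (algebraMap K E).injective
      rw [v3_cpt one_ne_zero hx]; simp
    rw [lam, e1, e2, e3]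

/-- Newton identities: a cubic and its power sums. -/
lemma newton_three (A S : ℕ → ℂ) (h0 : A 0 = 1) (hv : ∀ n, 4 ≤ n → A n = 0)
    (hN : ∀ n : ℕ, (n : ℂ) * A n = ∑ k ∈ Finset.Icc 1 n, S k * A (n - k)) :
    ∃ ω : Fin 3 → ℂ, ∀ k, k ≠ 0 → S k = - ∑ i, ω i ^ k := by
  let P : ℂ[X] := X ^ 3 + C (A 1) * X ^ 2 + C (A 2) * X + C (A 3)
  have hPm : P.Monic := by simp only [P]; monicity!
  have hPd : P.natDegree = 3 := by simp only [P]; compute_degree!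
  have hsp := (IsAlgClosed.splits P)
  have hcard : P.roots.card = 3 := by rw [← hsp.natDegree_eq_card_roots, hPd]
  obtain ⟨x, y, z, hxyz⟩ := Multiset.card_eq_three.1 hcard
  have hfac : P = (X - C x) * ((X - C y) * (X - C z)) := by
    have := hsp.eq_prod_roots_of_monic hPm
    rw [hxyz] at this
    simpa using this
  have hev : ∀ t : ℂ, t ^ 3 + A 1 * t ^ 2 + A 2 * t + A 3 = (t - x) * ((t - y) * (t - z)) := by
    intro t
    have := congrArg (eval t) hfac
    simpa [P] using this
  have a3 : A 3 = - (x * y * z) := by have := hev 0; linear_combination this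
  have a1 : A 1 = - (x + y + z) := by
    have h1 := hev 1; have h2 := hev (-1)
    linear_combination (1/2) * h1 + (1/2) * h2 - a3
  have a2 : A 2 = x * y + y * z + x * z := by
    have h1 := hev 1; 
    linear_combination h1 - a3 - a1
  have s1 : S 1 = A 1 := by
    have := hN 1
    simp [h0] at this; exact this.symm
  have s2 : S 2 = 2 * A 2 - S 1 * A 1 := by
    have := hN 2
    simp [Finset.sum_Icc_succ_top, h0] at this; linear_combination -this
  have s3 : S 3 = 3 * A 3 - S 1 * A 2 - S 2 * A 1 := by
    have := hN 3
    simp [Finset.sum_Icc_succ_top, h0] at this; linear_combination -this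
  have hrec : ∀ n, S (n + 4) = - (S (n + 3) * A 1 + S (n + 2) * A 2 + S (n + 1) * A 3) := by
    intro n
    have := hN (n + 4)
    rw [hv (n + 4) (by omega), mul_zero, Finset.sum_Icc_succ_top (by omega), Finset.sum_Icc_succ_top (by omega),
      Finset.sum_Icc_succ_top (by omega), Finset.sum_Icc_succ_top (by omega)] at this
    have hz : ∑ k ∈ Finset.Icc 1 n, S k * A (n + 4 - k) = 0 := by
      apply Finset.sum_eq_zero
      intro k hk
      rw [Finset.mem_Icc] at hk
      rw [hv _ (by omega), mul_zero]
    have t1 : n + 3 + 1 - (n + 1) = 3 := by omega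
    have t2 : n + 3 + 1 - (n + 2) = 2 := by omega
    have t3 : n + 3 + 1 - (n + 3) = 1 := by omega
    simp only [hz, show n + 4 - (n + 1) = 3 by omega, show n + 4 - (n + 1 + 1) = 2 by omega,
      show n + 4 - (n + 2 + 1) = 1 by omega, show n + 4 - (n + 3 + 1) = 0 by omega, h0] at this
    linear_combination -this
  have key : ∀ n, S (n + 1) = - (x ^ (n + 1) + y ^ (n + 1) + z ^ (n + 1)) ∧
      S (n + 2) = - (x ^ (n + 2) + y ^ (n + 2) + z ^ (n + 2)) ∧
      S (n + 3) = - (x ^ (n + 3) + y ^ (n + 3) + z ^ (n + 3)) := by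
    intro n
    induction n with
    | zero =>
      have e1 : S 1 = -(x + y + z) := by rw [s1, a1]
      have e2 : S 2 = -(x ^ 2 + y ^ 2 + z ^ 2) := by rw [s2, e1, a2, a1]; ring
      refine ⟨by simpa using e1, by simpa using e2, ?_⟩
      simp only [zero_add]
      rw [s3, e1, e2, a1, a2, a3]; ring
    | succ n ih =>
      obtain ⟨i1, i2, i3⟩ := ih
      refine ⟨i2, i3, ?_⟩
      show S (n + 4) = _
      rw [hrec, i1, i2, i3, a1, a2, a3]; ring
  refine ⟨![x, y, z], ?_⟩
  intro k hk
  obtain ⟨n, rfl⟩ := Nat.exists_eq_succ_of_ne_zero hk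
  rw [Fin.sum_univ_three]
  exact (key n).1

theorem LS_roots [IsAlgClosed E] (hodd : Fintype.card K % 2 = 1) (hs : QSplit B C0 ρ₁ ρ₂) (χ₁ χ₂ : MulChar K ℂ) (ψ : AddChar K ℂ)
    (hnt : ¬(χ₁ = 1 ∧ χ₂ = 1 ∧ ψ = 1)) :
    ∃ ω : Fin 3 → ℂ, ∀ k, k ≠ 0 → LS E B C0 χ₁ χ₂ ψ k = - ∑ i, ω i ^ k :=
  newton_three (LA B C0 χ₁ χ₂ ψ) _ (LA_zero hs _ _ _) (fun n hn => LA_vanish hodd hs _ _ _ hnt n hn)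
    (fun n => LA_newton hs _ _ _ n)

end VAL

section WL
variable {K : Type*} [Field K] [Fintype K] {E : Type*} [Field E] [Algebra K E]
variable {B C0 : K} {ρ₁ ρ₂ : E}

open Classical in
lemma sum_mulChar [Fintype (MulChar K ℂ)] (d : ℕ) (hd : Fintype.card K = d + 1) (y : K) :
    ∑ η : MulChar K ℂ, η y = if y = 1 then (d : ℂ) else 0 := by
  split_ifs with h
  · subst h
    simp only [MulChar.map_one, Finset.sum_const, Finset.card_univ, nsmul_eq_mul, mul_one]
    have := MulChar.card_eq_card_units_of_hasEnoughRootsOfUnity K ℂ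
    rw [Nat.card_eq_fintype_card, Nat.card_eq_fintype_card, Fintype.card_units, hd] at this
    rw [this]; simp
  · obtain ⟨χ, hχ⟩ := MulChar.exists_apply_ne_one_of_hasEnoughRootsOfUnity K ℂ h
    have h1 : χ y * ∑ η : MulChar K ℂ, η y = ∑ η : MulChar K ℂ, η y := by
      rw [Finset.mul_sum]
      apply Fintype.sum_equiv (Equiv.mulLeft χ)
      intro η
      simp [MulChar.mul_apply]
    have h2 : (χ y - 1) * ∑ η : MulChar K ℂ, η y = 0 := by linear_combination h1
    rcases mul_eq_zero.1 h2 with h3 | h3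
    · exact absurd (sub_eq_zero.1 h3) hχ
    · exact h3

lemma tr_as (z : E) (k : ℕ) :
    ∑ i ∈ Finset.range k, (z ^ Fintype.card K - z) ^ (Fintype.card K ^ i) = z ^ (Fintype.card K ^ k) - z := by
  induction k with
  | zero => simp
  | succ n ih =>
    rw [Finset.sum_range_succ, ih, sub_pow_card_pow K, ← pow_mul, ← pow_succ']
    ring

open Classical in
lemma as_fiber [IsAlgClosed E] {k : ℕ} (hk : k ≠ 0) {x : E} (hx : x ∈ ptsZ K E k) :
    (((ptsZ K E k).filter (fun z => z ^ Fintype.card K - z = x)).card : ℂ)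
      = if v3 (cpt K x k) = 0 then (Fintype.card K : ℂ) else 0 := by
  have hv : v3 (cpt K x k) = 0 ↔ ∑ i ∈ Finset.range k, x ^ (Fintype.card K ^ i) = 0 := by
    rw [← v3_cpt hk hx, map_eq_zero]
  split_ifs with h
  · rw [hv] at h
    obtain ⟨z, hz⟩ := as_surj (K := K) x
    have hcard : ((ptsZ K E k).filter (fun z => z ^ Fintype.card K - z = x)).card = (Finset.univ : Finset K).card := by
      symm
      apply Finset.card_bij (fun c _ => z + algebraMap K E c)
      · intro c _
        have e : (z + algebraMap K E c) ^ Fintype.card K - (z + algebraMap K E c) = x := by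
          have := sub_pow_card_pow K z (- algebraMap K E c) 1
          rw [pow_one, sub_neg_eq_add, ← map_neg, ← map_pow, FiniteField.pow_card, map_neg, sub_neg_eq_add] at this
          rw [this, ← hz]; ring
        rw [Finset.mem_filter]
        refine ⟨?_, e⟩
        rw [mem_ptsZ hk, ← sub_eq_zero, ← tr_as, e, h]
      · intro c _ c' _ hcc
        exact (algebraMap K E).injective (add_left_cancel hcc)
      · intro w hw
        rw [Finset.mem_filter] at hw
        have : (w - z) ^ Fintype.card K = w - z := by
          have := sub_pow_card_pow K w z 1
          rw [pow_one] at this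
          rw [this]
          linear_combination hw.2 - hz
        obtain ⟨y, hy⟩ := mem_range_of_pow_card this
        exact ⟨y, Finset.mem_univ _, by rw [hy]; ring⟩
    rw [hcard, Finset.card_univ]
  · rw [hv] at h
    rw [Finset.filter_eq_empty_iff.2]
    · simp
    · intro z hz hzx
      apply h
      rw [← hzx, tr_as, sub_eq_zero]
      exact (mem_ptsZ hk).1 hz

open Classical in
lemma total_sum [IsAlgClosed E] [Fintype (MulChar K ℂ)] (hs : QSplit B C0 ρ₁ ρ₂) (d : ℕ) (hd : Fintype.card K = d + 1)
    (a b : ℕ) (ha : a ≠ 0) (hb : b ≠ 0) {k : ℕ} (hk : k ≠ 0) :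
    ∑ u : MulChar K ℂ × AddChar K ℂ, LS E B C0 (u.1 ^ a) (u.1 ^ b) u.2 k
      = d * ((ptsZ K E k).filter (fun z =>
        ((z ^ Fintype.card K - z) ^ a * (aeval (z ^ Fintype.card K - z) (qf B C0)) ^ b)
          ^ (nexp (Fintype.card K) k) = 1)).card := by
  have h1 : ∀ x ∈ ptsZ K E k, ∑ u : MulChar K ℂ × AddChar K ℂ, lam B C0 (u.1 ^ a) (u.1 ^ b) u.2 (cpt K x k)
      = d * (if (x ^ a * (aeval x (qf B C0)) ^ b) ^ (nexp (Fintype.card K) k) = 1 then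
        (((ptsZ K E k).filter (fun z => z ^ Fintype.card K - z = x)).card : ℂ) else 0) := by
    intro x hx
    have hiff : (x ^ a * (aeval x (qf B C0)) ^ b) ^ (nexp (Fintype.card K) k) = 1 ↔
        v1 (cpt K x k) ^ a * v2 B C0 (cpt K x k) ^ b = 1 := by
      rw [← (algebraMap K E).injective.eq_iff, map_mul, map_pow, map_pow, v1_cpt hk hx, v2_cpt hs hk hx, map_one,
        mul_pow, ← pow_mul, ← pow_mul, ← pow_mul, ← pow_mul, mul_comm a, mul_comm b]
    rw [as_fiber hk hx, hiff, Fintype.sum_prod_type]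
    have : ∀ η : MulChar K ℂ, ∑ ψ : AddChar K ℂ, lam B C0 (η ^ a) (η ^ b) ψ (cpt K x k)
        = η (v1 (cpt K x k) ^ a * v2 B C0 (cpt K x k) ^ b) * ∑ ψ : AddChar K ℂ, ψ (v3 (cpt K x k)) := by
      intro η
      rw [Finset.mul_sum]
      apply Finset.sum_congr rfl
      intro ψ _
      rw [lam, MulChar.pow_apply' _ ha, MulChar.pow_apply' _ hb, map_mul, map_pow, map_pow]
    simp only [this]
    rw [← Finset.sum_mul, sum_mulChar d hd, AddChar.sum_apply_eq_ite]
    split_ifs <;> simp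
  simp only [LS]
  rw [Finset.sum_comm, Finset.sum_congr rfl h1, ← Finset.mul_sum]
  congr 1
  have h2 : ∀ z ∈ (ptsZ K E k).filter (fun z =>
        ((z ^ Fintype.card K - z) ^ a * (aeval (z ^ Fintype.card K - z) (qf B C0)) ^ b)
          ^ (nexp (Fintype.card K) k) = 1), z ^ Fintype.card K - z ∈ ptsZ K E k := by
    intro z hz
    have hz := (mem_ptsZ hk).1 (Finset.mem_filter.1 hz).1
    rw [mem_ptsZ hk, sub_pow_card_pow K, ← pow_mul, mul_comm, pow_mul, hz]
  rw [Finset.card_eq_sum_card_fiberwise h2]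
  push_cast
  apply Finset.sum_congr rfl
  intro x hx
  rw [Finset.filter_filter]
  split_ifs with h
  · congr 2
    apply Finset.filter_congr
    intro z _
    constructor
    · intro hz; exact ⟨by rw [hz]; exact h, hz⟩
    · exact fun hz => hz.2
  · symm
    rw [Nat.cast_eq_zero, Finset.card_eq_zero, Finset.filter_eq_empty_iff]
    rintro z _ ⟨h1, h2⟩
    rw [h2] at h1
    exact h h1

lemma triv_term [IsAlgClosed E] (hs : QSplit B C0 ρ₁ ρ₂) {k : ℕ} (hk : k ≠ 0) :
    ‖LS E B C0 1 1 1 k - (Fintype.card K : ℂ) ^ k‖ ≤ 3 := by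
  classical
  have h1 : LS E B C0 1 1 1 k - (Fintype.card K : ℂ) ^ k = ∑ x ∈ ptsZ K E k, (lam B C0 1 1 1 (cpt K x k) - 1) := by
    rw [Finset.sum_sub_distrib, LS, Finset.sum_const, card_ptsZ hk]
    simp
  rw [h1]
  have h2 : ∀ x ∈ ptsZ K E k, ‖lam B C0 1 1 1 (cpt K x k) - 1‖ ≤ if x ∈ ({0, ρ₁, ρ₂} : Finset E) then 1 else 0 := by
    intro x hx
    have e1 := v1_cpt hk hx
    have e2 := v2_cpt hs hk hx
    split_ifs with h
    · rw [lam]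
      by_cases c1 : v1 (cpt K x k) = 0
      · simp [c1, MulChar.map_zero]
      · by_cases c2 : v2 B C0 (cpt K x k) = 0
        · simp [c2, MulChar.map_zero]
        · rw [MulChar.one_apply (Ne.isUnit c1), MulChar.one_apply (Ne.isUnit c2)]; simp
    · simp only [Finset.mem_insert, Finset.mem_singleton, not_or] at h
      have c1 : v1 (cpt K x k) ≠ 0 := by
        intro c; rw [c, map_zero] at e1
        exact pow_ne_zero _ h.1 e1.symm
      have c2 : v2 B C0 (cpt K x k) ≠ 0 := by
        intro c; rw [c, map_zero, hs.aeval] at e2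
        exact pow_ne_zero _ (mul_ne_zero (sub_ne_zero.2 h.2.1) (sub_ne_zero.2 h.2.2)) e2.symm
      rw [lam, MulChar.one_apply (Ne.isUnit c1), MulChar.one_apply (Ne.isUnit c2)]; simp
  refine (norm_sum_le _ _).trans ((Finset.sum_le_sum h2).trans ?_)
  rw [← Finset.sum_filter, Finset.sum_const, nsmul_eq_mul, mul_one]
  have : ((ptsZ K E k).filter (fun x => x ∈ ({0, ρ₁, ρ₂} : Finset E))).card ≤ ({0, ρ₁, ρ₂} : Finset E).card := by
    apply Finset.card_le_card
    intro x hx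
    exact (Finset.mem_filter.1 hx).2
  exact_mod_cast this.trans Finset.card_le_three

theorem weil_coprime [IsAlgClosed E] (hodd : Fintype.card K % 2 = 1) (hs : QSplit B C0 ρ₁ ρ₂)
    (a b : ℕ) (ha : a ≠ 0) (hb : b ≠ 0) (hab : Nat.Coprime a b)
    (η : MulChar K ℂ) (ψ : AddChar K ℂ) (hnt : (η, ψ) ≠ (1, 1)) :
    ‖∑ x : K, (η ^ a) x * (η ^ b) (x ^ 2 + B * x + C0) * ψ x‖ ≤ 3 * Real.sqrt (Fintype.card K) := by
  classical
  haveI : Fintype (MulChar K ℂ) := Fintype.ofFinite _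
  have hQ1 : 1 < Fintype.card K := Fintype.one_lt_card
  obtain ⟨d, hd⟩ : ∃ d, Fintype.card K = d + 1 := ⟨Fintype.card K - 1, by omega⟩
  obtain ⟨Bd, l₀, hBd⟩ := count_final d hd (by omega) (qf B C0) ρ₁ ρ₂ hs.ne hs.map a b hab
  have hex : ∀ u : {u : MulChar K ℂ × AddChar K ℂ // u ≠ (1, 1)}, ∃ ω : Fin 3 → ℂ, ∀ k, k ≠ 0 →
      LS E B C0 (u.1.1 ^ a) (u.1.1 ^ b) u.1.2 k = - ∑ i, ω i ^ k := by
    intro u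
    apply LS_roots hodd hs
    rintro ⟨h1, h2, h3⟩
    apply u.2
    have : u.1.1 ^ (1 : ℕ) = 1 := by
      rw [← hab]
      exact orderOf_dvd_iff_pow_eq_one.1 (Nat.dvd_gcd (orderOf_dvd_iff_pow_eq_one.2 h1) (orderOf_dvd_iff_pow_eq_one.2 h2))
    rw [pow_one] at this
    exact Prod.ext this h3
  choose ω hω using hex
  have hQ0 : (0 : ℝ) < Fintype.card K := by exact_mod_cast (by omega : 0 < Fintype.card K)
  have hps := power_sum_bound (fun v : {u : MulChar K ℂ × AddChar K ℂ // u ≠ (1, 1)} × Fin 3 => ω v.1 v.2 ^ 2)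
    (Bd + 3) (Fintype.card K) hQ0 (l₀ + 1) (by
      intro l hl
      have hl2 : 2 * l ≠ 0 := by omega
      have h1 := total_sum (E := E) hs d hd a b ha hb hl2
      have h2 := hBd l (by omega)
      have h3 := triv_term hs hl2
      rw [Fintype.sum_prod_type]
      have h4 : ∀ u : {u : MulChar K ℂ × AddChar K ℂ // u ≠ (1, 1)}, ∑ i, (ω u i ^ 2) ^ l
          = - LS E B C0 (u.1.1 ^ a) (u.1.1 ^ b) u.1.2 (2 * l) := by
        intro u
        rw [hω u _ hl2, neg_neg]
        simp only [pow_mul]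
      simp only [h4]
      rw [Finset.sum_neg_distrib, norm_neg]
      rw [Fintype.sum_eq_add_sum_subtype_ne _ ((1 : MulChar K ℂ), (1 : AddChar K ℂ))] at h1
      simp only [one_pow] at h1
      set N := ((ptsZ K E (2 * l)).filter (fun z =>
        ((z ^ Fintype.card K - z) ^ a * (aeval (z ^ Fintype.card K - z) (qf B C0)) ^ b)
          ^ (nexp (Fintype.card K) (2 * l)) = 1)).card
      set S := ∑ u : {u : MulChar K ℂ × AddChar K ℂ // u ≠ (1, 1)}, LS E B C0 (u.1.1 ^ a) (u.1.1 ^ b) u.1.2 (2 * l)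
      have h5 : S = ((d * N - (Fintype.card K : ℝ) ^ (2 * l) : ℝ) : ℂ) - (LS E B C0 1 1 1 (2 * l) - (Fintype.card K : ℂ) ^ (2 * l)) := by
        push_cast
        linear_combination h1
      rw [h5]
      refine (norm_sub_le _ _).trans ?_
      rw [Complex.norm_real, Real.norm_eq_abs]
      have h6 : (1 : ℝ) ≤ (Fintype.card K : ℝ) ^ l := one_le_pow₀ (by exact_mod_cast hQ1.le)
      nlinarith)
  have h7 : ∀ i, ‖ω ⟨(η, ψ), hnt⟩ i‖ ≤ Real.sqrt (Fintype.card K) := by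
    intro i
    have := hps (⟨(η, ψ), hnt⟩, i)
    rw [norm_pow] at this
    exact Real.le_sqrt_of_sq_le this
  rw [← LS_one hs, hω ⟨(η, ψ), hnt⟩ 1 one_ne_zero, norm_neg, Fin.sum_univ_three]
  simp only [pow_one]
  refine (norm_add₃_le).trans ?_
  have := h7 0
  have := h7 1
  have := h7 2
  linarith

end WL

section WL
variable {K : Type*} [Field K] [Fintype K]

lemma chars_common (χ₁ χ₂ : MulChar K ℂ) : ∃ (η : MulChar K ℂ) (a b : ℕ), a ≠ 0 ∧ b ≠ 0 ∧ Nat.Coprime a b ∧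
    χ₁ = η ^ a ∧ χ₂ = η ^ b := by
  classical
  obtain ⟨e⟩ := MulChar.mulEquiv_units K ℂ
  haveI : IsCyclic (MulChar K ℂ) := isCyclic_of_surjective e.symm e.symm.surjective
  obtain ⟨χ, hχ⟩ := IsCyclic.exists_monoid_generator (α := MulChar K ℂ)
  have hex : ∀ y : MulChar K ℂ, ∃ n : ℕ, n ≠ 0 ∧ y = χ ^ n := by
    intro y
    obtain ⟨n, hn⟩ := hχ y
    refine ⟨n + orderOf χ, ?_, ?_⟩
    · have := orderOf_pos χ; omega
    · rw [pow_add, pow_orderOf_eq_one, mul_one]; exact hn.symm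
  obtain ⟨A, hA, rfl⟩ := hex χ₁
  obtain ⟨B, hB, rfl⟩ := hex χ₂
  have hg : 0 < Nat.gcd A B := Nat.gcd_pos_of_pos_left _ (Nat.pos_of_ne_zero hA)
  refine ⟨χ ^ Nat.gcd A B, A / Nat.gcd A B, B / Nat.gcd A B, ?_, ?_, Nat.coprime_div_gcd_div_gcd hg, ?_, ?_⟩
  · exact (Nat.div_pos (Nat.gcd_le_left _ (Nat.pos_of_ne_zero hA)) hg).ne'
  · exact (Nat.div_pos (Nat.gcd_le_right _ (Nat.pos_of_ne_zero hB)) hg).ne'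
  · rw [← pow_mul, Nat.mul_div_cancel' (Nat.gcd_dvd_left _ _)]
  · rw [← pow_mul, Nat.mul_div_cancel' (Nat.gcd_dvd_right _ _)]

lemma qsplit_exists (hodd : Fintype.card K % 2 = 1) (B C0 : K) (hD : B ^ 2 - 4 * C0 ≠ 0) :
    ∃ ρ₁ ρ₂ : AlgebraicClosure K, QSplit B C0 ρ₁ ρ₂ := by
  have hsp := IsAlgClosed.splits ((qf B C0).map (algebraMap K (AlgebraicClosure K)))
  have hm := (qf_monic B C0).map (algebraMap K (AlgebraicClosure K))
  have hcard : ((qf B C0).map (algebraMap K (AlgebraicClosure K))).roots.card = 2 := by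
    rw [← hsp.natDegree_eq_card_roots, natDegree_map, qf_natDegree]
  obtain ⟨x, y, hxy⟩ := Multiset.card_eq_two.1 hcard
  have hfac := hsp.eq_prod_roots_of_monic hm
  rw [hxy] at hfac
  have hfac' : (qf B C0).map (algebraMap K (AlgebraicClosure K)) = (X - C x) * (X - C y) := by
    rw [hfac]; simp
  refine ⟨x, y, ?_, hfac'⟩
  rintro rfl
  have hev : ∀ t : AlgebraicClosure K, t ^ 2 + algebraMap K _ B * t + algebraMap K _ C0 = (t - x) * (t - x) := by
    intro t
    have := congrArg (eval t) hfac'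
    simpa [qf] using this
  have c0 : algebraMap K (AlgebraicClosure K) C0 = x ^ 2 := by linear_combination hev 0
  have b0 : algebraMap K (AlgebraicClosure K) B = - 2 * x := by linear_combination hev 1 - c0
  apply hD
  apply (algebraMap K (AlgebraicClosure K)).injective
  have h4 : algebraMap K (AlgebraicClosure K) 4 = 4 := map_ofNat _ 4
  rw [map_sub, map_mul, map_pow, b0, c0, h4, map_zero]
  ring

theorem weil (hodd : Fintype.card K % 2 = 1) (a b c : K) (ha : a ≠ 0) (hdisc : b ^ 2 - 4 * a * c ≠ 0)
    (χ₁ χ₂ : MulChar K ℂ) (ψ : AddChar K ℂ) (hnt : ¬(χ₁ = 1 ∧ χ₂ = 1 ∧ ψ = 1)) :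
    ‖∑ x : K, χ₁ x * χ₂ (a * x ^ 2 + b * x + c) * ψ x‖ ≤ 3 * Real.sqrt (Fintype.card K) := by
  obtain ⟨η, m, n, hm, hn, hmn, rfl, rfl⟩ := chars_common χ₁ χ₂
  have hD : (b / a) ^ 2 - 4 * (c / a) ≠ 0 := by
    intro h
    apply hdisc
    field_simp at h
    linear_combination h
  obtain ⟨ρ₁, ρ₂, hs⟩ := qsplit_exists hodd (b / a) (c / a) hD
  have h1 := weil_coprime hodd hs m n hm hn hmn η ψ (by
    intro h
    rw [Prod.mk.injEq] at h
    apply hnt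
    rw [h.1, h.2]; simp)
  have h2 : ∑ x : K, (η ^ m) x * (η ^ n) (a * x ^ 2 + b * x + c) * ψ x
      = (η ^ n) a * ∑ x : K, (η ^ m) x * (η ^ n) (x ^ 2 + (b / a) * x + c / a) * ψ x := by
    rw [Finset.mul_sum]
    apply Finset.sum_congr rfl
    intro x _
    have : a * x ^ 2 + b * x + c = a * (x ^ 2 + (b / a) * x + c / a) := by field_simp
    rw [this, map_mul]; ring
  have h3 : ‖(η ^ n) a‖ = 1 := by
    have : (η ^ n) a ^ (Fintype.card K - 1) = 1 := by
      rw [← map_pow, FiniteField.pow_card_sub_one_eq_one a ha, MulChar.map_one]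
    exact Complex.norm_eq_one_of_pow_eq_one this (by have := Fintype.one_lt_card (α := K); omega)
  rw [h2, norm_mul, h3, one_mul]
  exact h1

end WL

section SV
variable {M : Type*} [AddCommGroup M] [Fintype M]

open Classical in
lemma sum_ann (H : AddSubgroup M) (α : M) :
    ∑ χ : AddChar M ℂ, (if ∀ h ∈ H, χ h = 1 then χ α else 0) = if α ∈ H then (H.index : ℂ) else 0 := by
  haveI : Fintype (M ⧸ H) := Fintype.ofFinite _
  have h1 := AddChar.sum_apply_eq_ite (α := M ⧸ H) (QuotientAddGroup.mk' H α)
  have h2 : (QuotientAddGroup.mk' H α = 0) ↔ α ∈ H := by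
    rw [QuotientAddGroup.mk'_apply, QuotientAddGroup.eq_zero_iff]
  have h3 : Fintype.card (M ⧸ H) = H.index := by
    rw [AddSubgroup.index, Nat.card_eq_fintype_card]
  simp only [h2, h3] at h1
  rw [← h1, ← Finset.sum_filter]
  symm
  apply Finset.sum_nbij (fun ψ : AddChar (M ⧸ H) ℂ => ψ.compAddMonoidHom (QuotientAddGroup.mk' H))
  · intro ψ _
    rw [Finset.mem_filter]
    refine ⟨Finset.mem_univ _, fun h hh => ?_⟩
    rw [AddChar.compAddMonoidHom_apply, QuotientAddGroup.mk'_apply, (QuotientAddGroup.eq_zero_iff h).2 hh,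
      AddChar.map_zero_eq_one]
  · intro a _ b _ hab
    ext x
    obtain ⟨y, rfl⟩ := QuotientAddGroup.mk'_surjective H x
    exact DFunLike.congr_fun hab y
  · intro χ hχ
    have hχ := (Finset.mem_filter.1 (Finset.mem_coe.1 hχ)).2
    let φ : M →+ Additive ℂ := AddChar.toAddMonoidHomEquiv χ
    have hφ : H ≤ φ.ker := by
      intro h hh
      rw [AddMonoidHom.mem_ker]
      exact hχ h hh
    refine ⟨AddChar.toAddMonoidHomEquiv.symm (QuotientAddGroup.lift H φ hφ), Finset.mem_coe.2 (Finset.mem_univ _), ?_⟩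
    ext x
    rfl
  · intro ψ _
    rfl

open Classical in
lemma sieve_one (H : AddSubgroup M) : ∃ c : AddChar M ℂ → ℂ, c 1 = 1 ∧
    (∀ χ, c χ ≠ 0 → ∀ z ∈ H, χ z = 1) ∧ ∑ χ, ‖c χ‖ ≤ 2 ∧
    ∀ α, (if α ∉ H then (1 : ℂ) else 0) = (1 - 1 / (H.index : ℂ)) * ∑ χ, c χ * χ α := by
  have hn0 : H.index ≠ 0 := AddSubgroup.index_ne_zero_of_finite
  by_cases hn1 : H.index = 1
  · refine ⟨fun χ => if χ = 1 then 1 else 0, by simp, ?_, ?_, ?_⟩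
    · intro χ hχ z _
      have : χ = 1 := by
        by_contra h
        simp [h] at hχ
      rw [this, AddChar.one_apply]
    · have : ∀ χ : AddChar M ℂ, ‖(if χ = 1 then (1 : ℂ) else 0)‖ = if χ = 1 then 1 else 0 := by
        intro χ; split_ifs <;> simp
      simp only [this]
      simp
    · intro α
      have : H = ⊤ := AddSubgroup.index_eq_one.1 hn1
      rw [hn1]
      simp [this]
  · have hn2 : (2 : ℝ) ≤ H.index := by exact_mod_cast (by omega : 2 ≤ H.index)
    set n := H.index with hn
    have hnC : (n : ℂ) ≠ 0 := by exact_mod_cast hn0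
    have hnC1 : (n : ℂ) - 1 ≠ 0 := by
      intro h
      have : (n : ℂ) = 1 := by linear_combination h
      exact hn1 (by exact_mod_cast this)
    have hcount := sum_ann H 0
    simp only [AddChar.map_zero_eq_one, H.zero_mem, if_true] at hcount
    refine ⟨fun χ => if χ = 1 then 1 else if ∀ h ∈ H, χ h = 1 then - 1 / ((n : ℂ) - 1) else 0, by simp, ?_, ?_, ?_⟩
    · intro χ hχ z hz
      by_cases h : χ = 1
      · rw [h, AddChar.one_apply]
      · by_contra hcon
        have : ¬ ∀ h ∈ H, χ h = 1 := fun hh => hcon (hh z hz)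
        simp [h, this] at hχ
    · have e : ∀ χ : AddChar M ℂ, ‖(if χ = 1 then (1 : ℂ) else if ∀ h ∈ H, χ h = 1 then - 1 / ((n : ℂ) - 1) else 0)‖
          = (if ∀ h ∈ H, χ h = 1 then (1 : ℝ) else 0) * (1 / ((n : ℝ) - 1)) + (if χ = 1 then 1 - 1 / ((n : ℝ) - 1) else 0) := by
        intro χ
        have hnorm : ‖(n : ℂ) - 1‖ = (n : ℝ) - 1 := by
          have : (n : ℂ) - 1 = (((n : ℝ) - 1 : ℝ) : ℂ) := by push_cast; ring
          rw [this, Complex.norm_real, Real.norm_of_nonneg (by linarith)]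
        by_cases h : χ = 1
        · subst h
          simp
        · by_cases h' : ∀ z ∈ H, χ z = 1
          · rw [if_neg h, if_pos h', if_pos h', if_neg h, norm_div, norm_neg, norm_one, hnorm]; ring
          · rw [if_neg h, if_neg h', if_neg h', if_neg h]; simp
      simp only [e]
      rw [Finset.sum_add_distrib, ← Finset.sum_mul]
      have hc' : ∑ χ : AddChar M ℂ, (if ∀ h ∈ H, χ h = 1 then (1 : ℝ) else 0) = n := by
        have : ((∑ χ : AddChar M ℂ, (if ∀ h ∈ H, χ h = 1 then (1 : ℝ) else 0) : ℝ) : ℂ) = ((n : ℝ) : ℂ) := by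
          push_cast
          rw [hn, ← hcount]
          apply Finset.sum_congr rfl
          intro χ _
          split_ifs <;> simp
        exact_mod_cast this
      rw [hc', Finset.sum_ite_eq' Finset.univ (1 : AddChar M ℂ)]
      simp only [Finset.mem_univ, if_true]
      have : (n : ℝ) - 1 ≠ 0 := by linarith
      have : (n : ℝ) * (1 / ((n : ℝ) - 1)) + (1 - 1 / ((n : ℝ) - 1)) = 2 := by
        field_simp; ring
      exact this.le
    · intro α
      have e : ∀ χ : AddChar M ℂ, (if χ = 1 then (1 : ℂ) else if ∀ h ∈ H, χ h = 1 then - 1 / ((n : ℂ) - 1) else 0) * χ α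
          = (if ∀ h ∈ H, χ h = 1 then χ α else 0) * (- 1 / ((n : ℂ) - 1)) + (if χ = 1 then 1 + 1 / ((n : ℂ) - 1) else 0) := by
        intro χ
        by_cases h : χ = 1
        · subst h
          simp; ring
        · by_cases h' : ∀ z ∈ H, χ z = 1
          · rw [if_neg h, if_pos h', if_pos h', if_neg h]; ring
          · rw [if_neg h, if_neg h', if_neg h', if_neg h]; simp
      simp only [e]
      rw [Finset.sum_add_distrib, ← Finset.sum_mul, sum_ann, Finset.sum_ite_eq' Finset.univ (1 : AddChar M ℂ)]
      simp only [Finset.mem_univ, if_true]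
      rw [← hn]
      by_cases h : α ∈ H
      · simp only [h, not_true, if_true, if_false]
        field_simp
        ring
      · simp only [h, not_false_eq_true, if_true, if_false]
        field_simp
        ring

open Classical in
theorem sieve {ι : Type*} (H : ι → AddSubgroup M) (I : Finset ι)
    (hco : ∀ s ⊆ I, ∀ j ∈ I, j ∉ s → ∀ x : M, ∃ y z, x = y + z ∧ y ∈ H j ∧ ∀ i ∈ s, z ∈ H i) :
    ∃ c : AddChar M ℂ → ℂ, c 1 = 1 ∧ (∀ χ, c χ ≠ 0 → ∀ z, (∀ i ∈ I, z ∈ H i) → χ z = 1) ∧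
      ∑ χ, ‖c χ‖ ≤ 2 ^ I.card ∧
      ∀ α, (if ∀ i ∈ I, α ∉ H i then (1 : ℂ) else 0)
        = (∏ i ∈ I, (1 - 1 / ((H i).index : ℂ))) * ∑ χ, c χ * χ α := by
  induction I using Finset.induction_on with
  | empty =>
    refine ⟨fun χ => if χ = 1 then 1 else 0, by simp, ?_, ?_, ?_⟩
    · intro χ hχ z _
      have : χ = 1 := by
        by_contra h
        simp [h] at hχ
      rw [this, AddChar.one_apply]
    · have : ∀ χ : AddChar M ℂ, ‖(if χ = 1 then (1 : ℂ) else 0)‖ = if χ = 1 then 1 else 0 := by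
        intro χ; split_ifs <;> simp
      simp only [this]
      simp
    · intro α
      simp
  | insert j I hj ih =>
    obtain ⟨c, hc1, hcs, hcn, hcα⟩ := ih (fun s hs i hi his x =>
      hco s (hs.trans (Finset.subset_insert _ _)) i (Finset.mem_insert_of_mem hi) his x)
    obtain ⟨c', hc1', hcs', hcn', hcα'⟩ := sieve_one (H j)
    have hco' := hco I (Finset.subset_insert _ _) j (Finset.mem_insert_self _ _) hj
    refine ⟨fun χ => ∑ χ', c χ' * c' (χ'⁻¹ * χ), ?_, ?_, ?_, ?_⟩
    · show ∑ χ', c χ' * c' (χ'⁻¹ * 1) = 1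
      rw [Finset.sum_eq_single (1 : AddChar M ℂ)]
      · simp [hc1, hc1']
      · intro χ _ hχ
        by_contra hne
        apply hχ
        have h1 := hcs χ (left_ne_zero_of_mul hne)
        have h2 := hcs' _ (right_ne_zero_of_mul hne)
        rw [mul_one] at h2
        ext x
        obtain ⟨y, z, rfl, hy, hz⟩ := hco' x
        have h3 := h2 (-y) (neg_mem hy)
        rw [AddChar.inv_apply, neg_neg] at h3
        rw [AddChar.map_add_eq_mul, h1 z hz, h3, AddChar.one_apply, mul_one]
      · intro h; exact absurd (Finset.mem_univ _) h
    · intro χ hχ z hz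
      obtain ⟨χ', -, hne⟩ := Finset.exists_ne_zero_of_sum_ne_zero hχ
      have h1 := hcs χ' (left_ne_zero_of_mul hne) z (fun i hi => hz i (Finset.mem_insert_of_mem hi))
      have h2 := hcs' _ (right_ne_zero_of_mul hne) z (hz j (Finset.mem_insert_self _ _))
      have : χ = χ' * (χ'⁻¹ * χ) := by group
      rw [this, AddChar.mul_apply, h1, h2, mul_one]
    · calc ∑ χ, ‖∑ χ', c χ' * c' (χ'⁻¹ * χ)‖ ≤ ∑ χ, ∑ χ', ‖c χ'‖ * ‖c' (χ'⁻¹ * χ)‖ := by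
            apply Finset.sum_le_sum
            intro χ _
            refine (norm_sum_le _ _).trans (le_of_eq ?_)
            simp only [norm_mul]
        _ = (∑ χ, ‖c χ‖) * ∑ χ, ‖c' χ‖ := by
            rw [Finset.sum_comm, Finset.sum_mul]
            apply Finset.sum_congr rfl
            intro χ' _
            rw [← Finset.mul_sum]
            congr 1
            exact Fintype.sum_equiv (Equiv.mulLeft χ'⁻¹) _ _ (fun χ => rfl)
        _ ≤ 2 ^ I.card * 2 := by
            apply mul_le_mul hcn hcn' (Finset.sum_nonneg (fun _ _ => norm_nonneg _)) (by positivity)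
        _ = 2 ^ (insert j I).card := by
            rw [Finset.card_insert_of_notMem hj, pow_succ]
    · intro α
      have h1 : (if ∀ i ∈ insert j I, α ∉ H i then (1 : ℂ) else 0)
          = (if ∀ i ∈ I, α ∉ H i then (1 : ℂ) else 0) * (if α ∉ H j then (1 : ℂ) else 0) := by
        simp only [Finset.forall_mem_insert]
        split_ifs <;> simp_all
      rw [h1, hcα, hcα', Finset.prod_insert hj]
      have h2 : ∑ χ, (∑ χ', c χ' * c' (χ'⁻¹ * χ)) * χ α = (∑ χ, c χ * χ α) * ∑ χ, c' χ * χ α := by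
        simp only [Finset.sum_mul]
        rw [Finset.sum_comm]
        apply Finset.sum_congr rfl
        intro χ' _
        rw [Finset.mul_sum]
        apply Fintype.sum_equiv (Equiv.mulLeft χ'⁻¹)
        intro χ
        have : χ α = χ' α * (χ'⁻¹ * χ) α := by
          rw [← AddChar.mul_apply]; congr 1; group
        rw [Equiv.coe_mulLeft, this]; ring
      rw [h2]
      ring

/-- the subgroup `i • M` -/
def smulSub {R : Type*} [CommRing R] (M : Type*) [AddCommGroup M] [Module R M] (i : R) : AddSubgroup M :=
  (DistribSMul.toAddMonoidHom M i).range

lemma mem_smulSub {R : Type*} [CommRing R] {M : Type*} [AddCommGroup M] [Module R M] {i : R} {x : M} :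
    x ∈ smulSub M i ↔ ∃ y : M, i • y = x := by
  simp [smulSub, AddMonoidHom.mem_range]

open Classical in
theorem sieve_mod {R : Type*} [CommRing R] [Module R M] (I : Finset R)
    (hI : ∀ i ∈ I, ∀ j ∈ I, i ≠ j → IsCoprime i j) :
    ∃ c : AddChar M ℂ → ℂ, c 1 = 1 ∧ ∑ χ, ‖c χ‖ ≤ 2 ^ I.card ∧
      ∀ α, (if ∀ i ∈ I, α ∉ smulSub M i then (1 : ℂ) else 0)
        = (∏ i ∈ I, (1 - 1 / ((smulSub M i).index : ℂ))) * ∑ χ, c χ * χ α := by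
  obtain ⟨c, h1, -, h2, h3⟩ := sieve (fun i : R => smulSub M i) I (by
    intro s hs j hj hjs x
    have hcop : IsCoprime j (∏ i ∈ s, i) := IsCoprime.prod_right (fun i hi => hI j hj i (hs hi) (fun h => hjs (h ▸ hi)))
    obtain ⟨u, v, huv⟩ := hcop
    refine ⟨j • (u • x), (∏ i ∈ s, i) • (v • x), ?_, mem_smulSub.2 ⟨_, rfl⟩, ?_⟩
    · rw [smul_smul, smul_smul, ← add_smul, mul_comm j, mul_comm _ v, huv, one_smul]
    · intro i hi
      rw [← Finset.mul_prod_erase s _ hi]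
      exact mem_smulSub.2 ⟨_, by rw [mul_smul]⟩)
  exact ⟨c, h1, h2, h3⟩

end SV

section AP

/-- multiplicative character from a character of the additive version of the units -/
noncomputable def mcOf {K : Type*} [Field K] (χ : AddChar (Additive Kˣ) ℂ) : MulChar K ℂ :=
  MulChar.ofUnitHom (MonoidHom.toHomUnits
    { toFun := fun u : Kˣ => χ (Additive.ofMul u)
      map_one' := by rw [ofMul_one, AddChar.map_zero_eq_one]
      map_mul' := fun u v => by rw [ofMul_mul, AddChar.map_add_eq_mul] })

lemma mcOf_coe {K : Type*} [Field K] (χ : AddChar (Additive Kˣ) ℂ) (u : Kˣ) :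
    mcOf χ (u : K) = χ (Additive.ofMul u) := by
  rw [mcOf, MulChar.ofUnitHom_coe, MonoidHom.coe_toHomUnits]; rfl

lemma mcOf_one {K : Type*} [Field K] : mcOf (1 : AddChar (Additive Kˣ) ℂ) = 1 := by
  ext u
  rw [mcOf_coe, AddChar.one_apply, MulChar.one_apply_coe]

lemma mcOf_eq_one {K : Type*} [Field K] {χ : AddChar (Additive Kˣ) ℂ} (h : mcOf χ = 1) : χ = 1 := by
  ext x
  have := mcOf_coe χ (Additive.toMul x)
  rw [h, MulChar.one_apply_coe] at this
  rw [AddChar.one_apply]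
  exact this.symm

open Classical in
theorem efree_sum {K : Type*} [Field K] [Fintype K] [Fintype (Additive Kˣ)] (e : ℕ) (he : e ∣ Fintype.card K - 1) :
    ∃ c : AddChar (Additive Kˣ) ℂ → ℂ, c 1 = 1 ∧ ∑ χ, ‖c χ‖ ≤ 2 ^ e.primeFactors.card ∧
      ∀ α : K, (if IsEFree e α then (1 : ℂ) else 0)
        = ((Nat.totient e : ℂ) / e) * ∑ χ, c χ * mcOf χ α := by
  have hQ : 1 < Fintype.card K := Fintype.one_lt_card
  have he0 : e ≠ 0 := by
    rintro rfl
    have := Nat.eq_zero_of_zero_dvd he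
    omega
  set I : Finset ℤ := e.primeFactors.image (fun n : ℕ => (n : ℤ)) with hI
  have hinj : Set.InjOn (fun n : ℕ => (n : ℤ)) e.primeFactors := fun a _ b _ h => Nat.cast_injective (R := ℤ) h
  obtain ⟨c, h1, h2, h3⟩ := sieve_mod (M := Additive Kˣ) (R := ℤ) I (by
    intro i hi j hj hij
    rw [hI, Finset.mem_image] at hi hj
    obtain ⟨a, ha, rfl⟩ := hi
    obtain ⟨b, hb, rfl⟩ := hj
    rw [Nat.isCoprime_iff_coprime]
    exact (Nat.coprime_primes (Nat.prime_of_mem_primeFactors ha) (Nat.prime_of_mem_primeFactors hb)).2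
      (fun h => hij (by rw [h])))
  refine ⟨c, h1, ?_, ?_⟩
  · rwa [hI, Finset.card_image_of_injOn hinj] at h2
  · have hidx : ∀ l ∈ e.primeFactors, (smulSub (Additive Kˣ) (l : ℤ)).index = l := by
      intro l hl
      have e1 : smulSub (Additive Kˣ) (l : ℤ) = (nsmulAddMonoidHom l : Additive Kˣ →+ Additive Kˣ).range := by
        ext x
        rw [mem_smulSub, AddMonoidHom.mem_range]
        simp
      rw [e1, IsAddCyclic.index_nsmulAddMonoidHom_range]
      have : Nat.card (Additive Kˣ) = Fintype.card K - 1 := by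
        rw [← Fintype.card_units, ← Nat.card_eq_fintype_card]; rfl
      rw [this]
      exact Nat.gcd_eq_right ((Nat.dvd_of_mem_primeFactors hl).trans he)
    have hprod : ∏ i ∈ I, (1 - 1 / ((smulSub (Additive Kˣ) i).index : ℂ)) = (Nat.totient e : ℂ) / e := by
      rw [hI, Finset.prod_image hinj]
      have h := congrArg (fun r : ℚ => (r : ℂ)) (Nat.totient_eq_mul_prod_factors e)
      push_cast at h
      rw [h, mul_div_cancel_left₀ _ (by exact_mod_cast he0)]
      apply Finset.prod_congr rfl
      intro l hl
      rw [hidx l hl, one_div]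
    intro α
    rcases eq_or_ne α 0 with rfl | hα
    · rw [if_neg (fun h => h.1 rfl)]
      simp [MulChar.map_zero]
    · obtain ⟨u, rfl⟩ : ∃ u : Kˣ, (u : K) = α := ⟨Units.mk0 α hα, rfl⟩
      have h4 := h3 (Additive.ofMul u)
      rw [hprod] at h4
      simp only [mcOf_coe]
      rw [← h4]
      congr 1
      apply propext
      constructor
      · rintro ⟨-, h⟩ i hi hmem
        rw [hI, Finset.mem_image] at hi
        obtain ⟨l, hl, rfl⟩ := hi
        obtain ⟨v, hv⟩ := mem_smulSub.1 hmem
        have := h l (Nat.dvd_of_mem_primeFactors hl) ⟨((Additive.toMul v : Kˣ) : K), by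
          have : u = (Additive.toMul v) ^ l := by
            have := congrArg Additive.toMul hv
            simpa using this.symm
          rw [this]; simp⟩
        exact (Nat.prime_of_mem_primeFactors hl).ne_one this
      · intro h
        refine ⟨hα, ?_⟩
        rintro d hd ⟨β, hβ⟩
        by_contra hd1
        obtain ⟨l, hl, t, rfl⟩ := Nat.exists_prime_and_dvd hd1
        have hβ0 : β ≠ 0 := by
          rintro rfl
          rw [zero_pow] at hβ
          · exact hα hβ
          · rintro h0; rw [h0] at hd; exact he0 (Nat.eq_zero_of_zero_dvd hd)
        refine h (l : ℤ) ?_ (mem_smulSub.2 ⟨Additive.ofMul (Units.mk0 β hβ0 ^ t), ?_⟩)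
        · rw [hI, Finset.mem_image]
          exact ⟨l, Nat.mem_primeFactors.2 ⟨hl, (dvd_mul_right _ _).trans hd, he0⟩, rfl⟩
        · rw [natCast_zsmul, ← ofMul_pow]
          congr 1
          ext
          rw [hβ, mul_comm l t]
          simp [pow_mul]

lemma card_quot {F : Type*} [Field F] [Fintype F] {P : F[X]} (hP : P.Monic) :
    Nat.card (F[X] ⧸ Ideal.span {P}) = Fintype.card F ^ P.natDegree := by
  haveI := hP.finite_quotient
  rw [Module.natCard_eq_pow_finrank (K := F), finrank_quotient_span_eq_natDegree, Nat.card_eq_fintype_card]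

lemma idx_cyclic {R : Type*} [CommRing R] {M : Type*} [AddCommGroup M] [Module R M] (x : M) (P : R)
    (hsurj : ∀ y : M, ∃ h : R, h • x = y) (hker : ∀ h : R, h • x = 0 → P ∣ h) :
    (smulSub M P).index = Nat.card (R ⧸ Ideal.span {P}) := by
  let f : R →+ M := (LinearMap.toSpanSingleton R M x).toAddMonoidHom
  have hf : Function.Surjective f := fun y => by
    obtain ⟨h, hh⟩ := hsurj y
    exact ⟨h, hh⟩
  rw [← AddSubgroup.index_comap_of_surjective _ hf]
  have : (smulSub M P).comap f = (Ideal.span {P}).toAddSubgroup := by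
    ext h
    rw [AddSubgroup.mem_comap, mem_smulSub, Submodule.mem_toAddSubgroup, Ideal.mem_span_singleton]
    constructor
    · rintro ⟨y, hy⟩
      obtain ⟨u, rfl⟩ := hsurj y
      have h1 : (h - P * u) • x = 0 := by
        rw [sub_smul, mul_smul, hy]
        exact sub_self _
      have := dvd_add (hker _ h1) (dvd_mul_right P u)
      simpa using this
    · rintro ⟨u, rfl⟩
      exact ⟨u • x, by rw [← mul_smul]; rfl⟩
  rw [this]
  rfl

end AP

section GP
variable {F : Type*} [Field F] [Fintype F]

open Classical in
/-- monic irreducible factors -/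
noncomputable def mif (g : F[X]) : Finset F[X] := (UniqueFactorizationMonoid.normalizedFactors g).toFinset

lemma mem_mif {g P : F[X]} (hg : g ≠ 0) : P ∈ mif g ↔ Irreducible P ∧ P.Monic ∧ P ∣ g := by
  classical
  rw [mif, Multiset.mem_toFinset, Polynomial.mem_normalizedFactors_iff hg]

lemma mif_coprime {g : F[X]} (hg : g ≠ 0) : ∀ i ∈ mif g, ∀ j ∈ mif g, i ≠ j → IsCoprime i j := by
  intro i hi j hj hij
  rw [mem_mif hg] at hi hj
  rw [Irreducible.coprime_iff_not_dvd hi.1]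
  intro hd
  exact hij (eq_of_monic_of_associated hi.2.1 hj.2.1 (hi.1.associated_of_dvd hj.1 hd))

lemma exists_mif_dvd {g h : F[X]} (hg : g ≠ 0) (hh : h ∣ g) (hu : ¬ IsUnit h) : ∃ P ∈ mif g, P ∣ h := by
  classical
  obtain ⟨i, hi, hdi⟩ := WfDvdMonoid.exists_irreducible_factor hu (ne_zero_of_dvd_ne_zero hg hh)
  refine ⟨normalize i, ?_, normalize_dvd_iff.2 hdi⟩
  rw [mem_mif hg]
  exact ⟨(associated_normalize i).irreducible hi, monic_normalize hi.ne_zero, normalize_dvd_iff.2 (hdi.trans hh)⟩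

theorem units_card {g : F[X]} (hg : g.Monic) :
    (Nat.card ((F[X] ⧸ Ideal.span {g})ˣ) : ℂ) / (Fintype.card F : ℂ) ^ g.natDegree
      = ∏ P ∈ mif g, (1 - 1 / ((Fintype.card F : ℂ) ^ P.natDegree)) := by
  classical
  have hg0 := hg.ne_zero
  let M := F[X] ⧸ Ideal.span {g}
  have hcard := card_quot hg
  have hq0 : (Fintype.card F : ℂ) ≠ 0 := by exact_mod_cast Fintype.card_ne_zero
  haveI : Finite M := Nat.finite_of_card_ne_zero (by rw [hcard]; exact pow_ne_zero _ Fintype.card_ne_zero)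
  haveI : Fintype M := Fintype.ofFinite _
  obtain ⟨c, h1, -, h3⟩ := sieve_mod (M := M) (R := F[X]) (mif g) (mif_coprime hg0)
  have hsm : ∀ P y : F[X], P • (Ideal.Quotient.mk (Ideal.span {g}) y : M) = Ideal.Quotient.mk (Ideal.span {g}) (P * y) := fun P y => rfl
  have hone : ∀ h : F[X], h • (1 : M) = Ideal.Quotient.mk (Ideal.span {g}) h := by
    intro h
    have := hsm h 1
    rw [mul_one] at this
    exact this
  have hidx : ∀ P ∈ mif g, (smulSub M P).index = Fintype.card F ^ P.natDegree := by
    intro P hP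
    rw [mem_mif hg0] at hP
    rw [← card_quot hP.2.1]
    apply idx_cyclic (1 : M)
    · intro y
      obtain ⟨h, rfl⟩ := Ideal.Quotient.mk_surjective y
      exact ⟨h, hone h⟩
    · intro h hh
      rw [hone, Ideal.Quotient.eq_zero_iff_dvd] at hh
      exact hP.2.2.trans hh
  have hunit : ∀ α : M, IsUnit α ↔ ∀ P ∈ mif g, α ∉ smulSub M P := by
    intro α
    constructor
    · intro hu P hP hmem
      rw [mem_mif hg0] at hP
      obtain ⟨y, rfl⟩ := mem_smulSub.1 hmem
      obtain ⟨⟨_, v, hv, _⟩, rfl⟩ := hu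
      obtain ⟨y, rfl⟩ := Ideal.Quotient.mk_surjective y
      obtain ⟨v, rfl⟩ := Ideal.Quotient.mk_surjective v
      have hP2 : P • Ideal.Quotient.mk (Ideal.span {g}) y = Ideal.Quotient.mk (Ideal.span {g}) (P * y) := hsm P y
      simp only [hP2] at hv
      rw [← map_mul, ← map_one (Ideal.Quotient.mk (Ideal.span {g})), Ideal.Quotient.eq, Ideal.mem_span_singleton] at hv
      have h5 : P ∣ P * y * v - 1 := hP.2.2.trans hv
      have h6 : P ∣ 1 := by
        have := dvd_sub ((dvd_mul_right P (y * v))) h5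
        have e : P * (y * v) - (P * y * v - 1) = 1 := by ring
        rwa [e] at this
      exact hP.1.not_isUnit (isUnit_of_dvd_one h6)
    · intro h
      obtain ⟨a, rfl⟩ := Ideal.Quotient.mk_surjective α
      have hcop : IsCoprime a g := by
        rw [← EuclideanDomain.gcd_isUnit_iff]
        by_contra hnu
        obtain ⟨P, hP, hPd⟩ := exists_mif_dvd hg0 (EuclideanDomain.gcd_dvd_right a g) hnu
        obtain ⟨t, ht⟩ := hPd.trans (EuclideanDomain.gcd_dvd_left a g)
        apply h P hP
        refine mem_smulSub.2 ⟨Ideal.Quotient.mk _ t, ?_⟩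
        rw [ht]; exact hsm P t
      obtain ⟨u, v, huv⟩ := hcop
      refine IsUnit.of_mul_eq_one (Ideal.Quotient.mk _ u) ?_
      rw [← map_mul, ← map_one (Ideal.Quotient.mk (Ideal.span {g})), Ideal.Quotient.eq, Ideal.mem_span_singleton]
      exact ⟨-v, by rw [← huv]; ring⟩
  have hcount : (Nat.card Mˣ : ℂ) = ∑ α : M, (if ∀ P ∈ mif g, α ∉ smulSub M P then (1 : ℂ) else 0) := by
    simp only [← hunit]
    rw [← Finset.sum_filter, Finset.sum_const, nsmul_eq_mul, mul_one, Nat.card_eq_fintype_card, ← Finset.card_univ]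
    congr 1
    apply Finset.card_bij (fun (u : Mˣ) _ => (u : M))
    · intro u _
      simp
    · intro u _ v _ h
      exact Units.ext h
    · intro b hb
      obtain ⟨u, rfl⟩ := (Finset.mem_filter.1 hb).2
      exact ⟨u, Finset.mem_univ _, rfl⟩
  have hsum : ∑ α : M, ∑ χ, c χ * χ α = (Fintype.card F : ℂ) ^ g.natDegree := by
    rw [Finset.sum_comm, Finset.sum_eq_single (1 : AddChar M ℂ)]
    · simp only [h1, AddChar.one_apply, mul_one, Finset.sum_const, nsmul_eq_mul, Finset.card_univ]
      rw [← Nat.card_eq_fintype_card, hcard]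
      push_cast; rfl
    · intro χ _ hχ
      rw [← Finset.mul_sum, AddChar.sum_eq_zero_of_ne_one hχ, mul_zero]
    · intro h; exact absurd (Finset.mem_univ _) h
  have hfin : (Nat.card Mˣ : ℂ) = (∏ P ∈ mif g, (1 - 1 / ((Fintype.card F : ℂ) ^ P.natDegree))) * (Fintype.card F : ℂ) ^ g.natDegree := by
    rw [hcount]
    simp only [h3]
    rw [← Finset.mul_sum, hsum]
    congr 1
    apply Finset.prod_congr rfl
    intro P hP
    rw [hidx P hP]; push_cast; rfl
  show (Nat.card Mˣ : ℂ) / _ = _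
  rw [hfin, mul_div_cancel_right₀ _ (pow_ne_zero _ hq0)]

variable {K : Type*} [Field K] [Fintype K] [Algebra F K]

lemma polyAct_eq (h : F[X]) (x : K) :
    polyAct F h x = aeval (FiniteField.frobeniusAlgHom F K).toLinearMap h x := by
  rw [polyAct, aeval_eq_sum_range, Polynomial.sum_over_range]
  · simp only [LinearMap.sum_apply, LinearMap.smul_apply]
    apply Finset.sum_congr rfl
    intro i _
    rw [Algebra.smul_def]
    congr 1
    have : ∀ i : ℕ, ((FiniteField.frobeniusAlgHom F K).toLinearMap ^ i) x = x ^ (Fintype.card F) ^ i := by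
      intro i
      induction i with
      | zero => simp
      | succ n ih =>
        rw [pow_succ', Module.End.mul_apply, ih]
        simp [pow_succ, pow_mul]
    rw [this]
  · intro i; simp

open Classical in
theorem gfree_sum {m : ℕ} (hm : m ≠ 0) (hK : Module.finrank F K = m) {g : F[X]} (hg : g.Monic) (hgd : g ∣ X ^ m - 1) :
    ∃ c : AddChar K ℂ → ℂ, c 1 = 1 ∧ ∑ χ, ‖c χ‖ ≤ 2 ^ (mif g).card ∧
      ∀ α : K, (if IsGFree F g α then (1 : ℂ) else 0)
        = ((Nat.card ((F[X] ⧸ Ideal.span {g})ˣ) : ℂ) / (Fintype.card F : ℂ) ^ g.natDegree) * ∑ χ, c χ * χ α := by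
  have hg0 := hg.ne_zero
  letI : Module F[X] K := Module.compHom K (aeval (R := F) (FiniteField.frobeniusAlgHom F K).toLinearMap).toRingHom
  have hact : ∀ (h : F[X]) (x : K), h • x = polyAct F h x := fun h x => by rw [polyAct_eq]; rfl
  have hact' : ∀ (h : F[X]) (x : K), h • x = aeval (FiniteField.frobeniusAlgHom F K).toLinearMap h x := fun h x => rfl
  have hfin : Module.Finite F[X] K := by
    refine ⟨⟨Finset.univ, ?_⟩⟩
    rw [eq_top_iff]
    intro x _
    exact Submodule.subset_span (by simp)
  obtain ⟨x, hx⟩ := Module.exists_ker_toSpanSingleton_eq_annihilator F[X] K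
  have hker : ∀ h : F[X], h • x = 0 ↔ X ^ m - 1 ∣ h := by
    intro h
    have h1 : h • x = 0 ↔ h ∈ Module.annihilator F[X] K := by
      rw [← hx, LinearMap.mem_ker]; rfl
    rw [h1, Module.mem_annihilator, ← hK, ← FiniteField.minpoly_frobeniusAlgHom F K, minpoly.dvd_iff]
    constructor
    · intro h; ext y; exact h y
    · intro h y; rw [hact', h]; rfl
  have hXm : (X ^ m - 1 : F[X]).Monic := by
    have := monic_X_pow_sub_C (1 : F) hm
    rwa [C_1] at this
  have hsurj : ∀ y : K, ∃ h : F[X], h • x = y := by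
    let f : F[X] →+ K := (LinearMap.toSpanSingleton F[X] K x).toAddMonoidHom
    have hk : f.ker = (Ideal.span {(X ^ m - 1 : F[X])}).toAddSubgroup := by
      ext h
      rw [AddMonoidHom.mem_ker, Submodule.mem_toAddSubgroup, Ideal.mem_span_singleton]
      exact hker h
    have h1 := AddSubgroup.index_ker f
    have h2 : f.ker.index = Nat.card (F[X] ⧸ Ideal.span {(X ^ m - 1 : F[X])}) := by rw [hk]; rfl
    have hdeg : (X ^ m - 1 : F[X]).natDegree = m := by
      have := natDegree_X_pow_sub_C (n := m) (r := (1 : F))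
      rwa [C_1] at this
    rw [h2, card_quot hXm, hdeg] at h1
    have h3 : f.range = ⊤ := by
      apply AddSubgroup.eq_top_of_card_eq
      rw [← h1, Module.natCard_eq_pow_finrank (K := F) (V := K), hK, Nat.card_eq_fintype_card]
    intro y
    have : y ∈ f.range := by rw [h3]; trivial
    exact this
  obtain ⟨c, h1, h2, h3⟩ := sieve_mod (M := K) (R := F[X]) (mif g) (mif_coprime hg0)
  refine ⟨c, h1, h2, ?_⟩
  intro α
  have hprod : ∏ P ∈ mif g, (1 - 1 / ((smulSub K P).index : ℂ))
      = ((Nat.card ((F[X] ⧸ Ideal.span {g})ˣ) : ℂ) / (Fintype.card F : ℂ) ^ g.natDegree) := by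
    rw [units_card hg]
    apply Finset.prod_congr rfl
    intro P hP
    rw [mem_mif hg0] at hP
    rw [idx_cyclic x P hsurj (fun h hh => (hP.2.2.trans hgd).trans ((hker h).1 hh)), card_quot hP.2.1]
    push_cast; rfl
  rw [← hprod, ← h3]
  congr 1
  apply propext
  constructor
  · intro h P hP hmem
    rw [mem_mif hg0] at hP
    obtain ⟨y, hy⟩ := mem_smulSub.1 hmem
    have := h P hP.2.1 hP.2.2 ⟨y, by rw [← hact, hy]⟩
    exact hP.1.ne_one this
  · intro h t ht htg hex
    obtain ⟨β, hβ⟩ := hex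
    by_contra ht1
    obtain ⟨P, hP, s, rfl⟩ := exists_mif_dvd hg0 htg (fun hu => ht1 (ht.eq_one_of_isUnit hu))
    refine h P hP (mem_smulSub.2 ⟨s • β, ?_⟩)
    rw [← mul_smul, hact, hβ]

end GP

section Final

lemma quad_roots_card {K : Type*} [Field K] [Fintype K] [DecidableEq K] (a b c : K) (ha : a ≠ 0) :
    (Finset.univ.filter (fun x : K => a * x ^ 2 + b * x + c = 0)).card ≤ 2 := by
  have hd : (C a * X ^ 2 + C b * X + C c : K[X]).natDegree = 2 := natDegree_quadratic ha
  have h0 : (C a * X ^ 2 + C b * X + C c : K[X]) ≠ 0 := by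
    intro h; rw [h] at hd; simp at hd
  calc _ ≤ (C a * X ^ 2 + C b * X + C c : K[X]).roots.toFinset.card := by
        apply Finset.card_le_card
        intro x hx
        rw [Multiset.mem_toFinset, mem_roots h0]
        simpa using hx
    _ ≤ Multiset.card (C a * X ^ 2 + C b * X + C c : K[X]).roots := Multiset.toFinset_card_le _
    _ ≤ _ := (card_roots' _).trans hd.le

lemma triv_bound {K : Type*} [Field K] [Fintype K] (a b c : K) (ha : a ≠ 0) :
    ‖(∑ x : K, (1 : MulChar K ℂ) x * (1 : MulChar K ℂ) (a * x ^ 2 + b * x + c) * (1 : AddChar K ℂ) x)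
      - (Fintype.card K : ℂ)‖ ≤ 3 := by
  classical
  have e : (∑ x : K, (1 : MulChar K ℂ) x * (1 : MulChar K ℂ) (a * x ^ 2 + b * x + c) * (1 : AddChar K ℂ) x)
      - (Fintype.card K : ℂ) = ∑ x : K, ((1 : MulChar K ℂ) x * (1 : MulChar K ℂ) (a * x ^ 2 + b * x + c) - 1) := by
    rw [Finset.sum_sub_distrib]
    simp
  have h1 : ∀ y : K, (1 : MulChar K ℂ) y = if y = 0 then 0 else 1 := by
    intro y
    split_ifs with h
    · rw [h]; exact MulChar.map_zero _
    · exact MulChar.one_apply (Ne.isUnit h)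
  rw [e]
  calc _ ≤ ∑ x : K, ‖((1 : MulChar K ℂ) x * (1 : MulChar K ℂ) (a * x ^ 2 + b * x + c) - 1)‖ := norm_sum_le _ _
    _ ≤ ∑ x : K, ((if x = 0 then (1 : ℝ) else 0) + (if a * x ^ 2 + b * x + c = 0 then (1 : ℝ) else 0)) := by
        apply Finset.sum_le_sum
        intro x _
        rw [h1, h1]
        split_ifs <;> norm_num
    _ ≤ 3 := by
        rw [Finset.sum_add_distrib]
        have h2 := quad_roots_card a b c ha
        have h3 : (∑ x : K, (if a * x ^ 2 + b * x + c = 0 then (1 : ℝ) else 0)) ≤ 2 := by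
          rw [Finset.sum_boole]; exact_mod_cast h2
        have h4 : (∑ x : K, (if x = 0 then (1 : ℝ) else 0)) = 1 := by simp
        linarith

lemma main_complex {K : Type*} [Field K] [Fintype K] [Fintype (Additive Kˣ)] (hodd : Fintype.card K % 2 = 1)
    (a b c : K) (ha : a ≠ 0) (hdisc : b ^ 2 - 4 * a * c ≠ 0)
    (c₁ c₂ : AddChar (Additive Kˣ) ℂ → ℂ) (c₃ : AddChar K ℂ → ℂ)
    (h₁ : c₁ 1 = 1) (h₂ : c₂ 1 = 1) (h₃ : c₃ 1 = 1) (W₁ W₂ W₃ : ℝ)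
    (b₁ : ∑ χ, ‖c₁ χ‖ ≤ W₁) (b₂ : ∑ χ, ‖c₂ χ‖ ≤ W₂) (b₃ : ∑ χ, ‖c₃ χ‖ ≤ W₃) :
    ‖(∑ x : K, (∑ χ, c₁ χ * mcOf χ x) * (∑ χ, c₂ χ * mcOf χ (a * x ^ 2 + b * x + c)) * (∑ χ, c₃ χ * χ x))
      - (Fintype.card K : ℂ)‖ ≤ 3 * Real.sqrt (Fintype.card K) * (W₁ * W₂ * W₃) := by
  classical
  let S : AddChar (Additive Kˣ) ℂ → AddChar (Additive Kˣ) ℂ → AddChar K ℂ → ℂ := fun u v w =>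
    ∑ x : K, mcOf u x * mcOf v (a * x ^ 2 + b * x + c) * w x
  have hQ : (1 : ℝ) ≤ Real.sqrt (Fintype.card K) := by
    rw [Real.one_le_sqrt]; exact_mod_cast Fintype.card_pos
  have hS : ∀ u v w, ‖S u v w - (if u = 1 ∧ v = 1 ∧ w = 1 then (Fintype.card K : ℂ) else 0)‖ ≤ 3 * Real.sqrt (Fintype.card K) := by
    intro u v w
    split_ifs with h
    · obtain ⟨rfl, rfl, rfl⟩ := h
      have := triv_bound a b c ha
      simp only [S, mcOf_one]
      linarith
    · rw [sub_zero]
      apply weil hodd a b c ha hdisc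
      rintro ⟨hu, hv, hw⟩
      exact h ⟨mcOf_eq_one hu, mcOf_eq_one hv, hw⟩
  have e1 : (∑ x : K, (∑ χ, c₁ χ * mcOf χ x) * (∑ χ, c₂ χ * mcOf χ (a * x ^ 2 + b * x + c)) * (∑ χ, c₃ χ * χ x))
      = ∑ u, ∑ v, ∑ w, c₁ u * c₂ v * c₃ w * S u v w := by
    have : ∀ x : K, (∑ χ, c₁ χ * mcOf χ x) * (∑ χ, c₂ χ * mcOf χ (a * x ^ 2 + b * x + c)) * (∑ χ, c₃ χ * χ x)
        = ∑ u, ∑ v, ∑ w, c₁ u * c₂ v * c₃ w * (mcOf u x * mcOf v (a * x ^ 2 + b * x + c) * w x) := by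
      intro x
      rw [Finset.sum_mul_sum, Finset.sum_mul]
      refine Finset.sum_congr rfl fun u _ => ?_
      rw [Finset.sum_mul_sum]
      refine Finset.sum_congr rfl fun v _ => Finset.sum_congr rfl fun w _ => ?_
      ring
    simp only [this]
    rw [Finset.sum_comm]
    refine Finset.sum_congr rfl fun u _ => ?_
    rw [Finset.sum_comm]
    refine Finset.sum_congr rfl fun v _ => ?_
    rw [Finset.sum_comm]
    refine Finset.sum_congr rfl fun w _ => ?_
    rw [Finset.mul_sum]
  have e2 : (Fintype.card K : ℂ) = ∑ u, ∑ v, ∑ w, c₁ u * c₂ v * c₃ w * (if u = 1 ∧ v = 1 ∧ w = 1 then (Fintype.card K : ℂ) else 0) := by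
    rw [Finset.sum_eq_single (1 : AddChar (Additive Kˣ) ℂ) _ (fun h => absurd (Finset.mem_univ _) h),
      Finset.sum_eq_single (1 : AddChar (Additive Kˣ) ℂ) _ (fun h => absurd (Finset.mem_univ _) h),
      Finset.sum_eq_single (1 : AddChar K ℂ) _ (fun h => absurd (Finset.mem_univ _) h)]
    · simp [h₁, h₂, h₃]
    · intro w _ hw; simp [hw]
    · intro w _ hw; simp [hw]
    · intro w _ hw; simp [hw]
  have e3 : (∑ u, ∑ v, ∑ w, c₁ u * c₂ v * c₃ w * S u v w) - (Fintype.card K : ℂ)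
      = ∑ u, ∑ v, ∑ w, c₁ u * c₂ v * c₃ w * (S u v w - (if u = 1 ∧ v = 1 ∧ w = 1 then (Fintype.card K : ℂ) else 0)) := by
    conv_lhs => rw [e2]
    simp only [← Finset.sum_sub_distrib, ← mul_sub]
  rw [e1, e3]
  calc _ ≤ ∑ u, ∑ v, ∑ w, ‖c₁ u‖ * ‖c₂ v‖ * ‖c₃ w‖ * (3 * Real.sqrt (Fintype.card K)) := by
        refine (norm_sum_le _ _).trans (Finset.sum_le_sum fun u _ => ?_)
        refine (norm_sum_le _ _).trans (Finset.sum_le_sum fun v _ => ?_)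
        refine (norm_sum_le _ _).trans (Finset.sum_le_sum fun w _ => ?_)
        rw [norm_mul, norm_mul, norm_mul]
        exact mul_le_mul_of_nonneg_left (hS u v w) (by positivity)
    _ = 3 * Real.sqrt (Fintype.card K) * ((∑ u, ‖c₁ u‖) * (∑ v, ‖c₂ v‖) * (∑ w, ‖c₃ w‖)) := by
        rw [Finset.sum_mul_sum, Finset.sum_mul, Finset.mul_sum]
        refine Finset.sum_congr rfl fun u _ => ?_
        rw [Finset.sum_mul_sum, Finset.mul_sum]
        refine Finset.sum_congr rfl fun v _ => ?_
        rw [Finset.mul_sum]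
        refine Finset.sum_congr rfl fun w _ => ?_
        ring
    _ ≤ _ := by
        have n1 : 0 ≤ ∑ u, ‖c₁ u‖ := Finset.sum_nonneg fun _ _ => norm_nonneg _
        have n2 : 0 ≤ ∑ u, ‖c₂ u‖ := Finset.sum_nonneg fun _ _ => norm_nonneg _
        have n3 : 0 ≤ ∑ u, ‖c₃ u‖ := Finset.sum_nonneg fun _ _ => norm_nonneg _
        apply mul_le_mul_of_nonneg_left _ (by positivity)
        apply mul_le_mul (mul_le_mul b₁ b₂ n2 (n1.trans b₁)) b₃ n3
        exact mul_nonneg (n1.trans b₁) (n2.trans b₂)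

end Final

/-- Lower bound for `N(e₁, e₂, g)`:
`N(e₁,e₂,g) ≥ θ(e₁) θ(e₂) Θ(g) q^{m/2} (q^{m/2} - 3 W(e₁) W(e₂) Ω(g))`. -/
theorem NCount_lower_bound (p r q m : ℕ) (hp : p.Prime) (hodd : Odd p) (hr : 0 < r)
    (hq : q = p ^ r) (hm : 2 ≤ m)
    (F K : Type*) [Field F] [Fintype F] [DecidableEq F] [Field K] [Algebra F K]
    (hF : Fintype.card F = q) (hK : Module.finrank F K = m)
    (a b c : K) (ha : a ≠ 0) (hdisc : b ^ 2 - 4 * a * c ≠ 0)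
    (e₁ e₂ : ℕ) (he₁ : e₁ ∣ q ^ m - 1) (he₂ : e₂ ∣ q ^ m - 1)
    (g : Polynomial F) (hg : g.Monic) (hgdvd : g ∣ X ^ m - 1) :
    (NCount F a b c e₁ e₂ g : ℝ) ≥
      ((Nat.totient e₁ : ℝ) / e₁) * ((Nat.totient e₂ : ℝ) / e₂) *
        ((Nat.card ((Polynomial F ⧸ Ideal.span {g})ˣ) : ℝ) / (q : ℝ) ^ g.natDegree) *
        Real.sqrt ((q : ℝ) ^ m) *
        (Real.sqrt ((q : ℝ) ^ m) -
          3 * 2 ^ e₁.primeFactors.card * 2 ^ e₂.primeFactors.card *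
            2 ^ (UniqueFactorizationMonoid.normalizedFactors g).toFinset.card) := by
  have hfd : FiniteDimensional F K := FiniteDimensional.of_finrank_pos (by omega)
  haveI : Finite K := Module.finite_of_finite F
  letI : Fintype K := Fintype.ofFinite K
  letI : Fintype (Additive Kˣ) := Fintype.ofFinite _
  have hcK : Fintype.card K = q ^ m := by
    rw [Module.card_eq_pow_finrank (K := F) (V := K), hK, hF]
  have hKodd : Fintype.card K % 2 = 1 := by
    rw [hcK, hq, ← Nat.odd_iff]
    exact (hodd.pow).pow
  obtain ⟨c₁, h₁, b₁, s₁⟩ := efree_sum (K := K) e₁ (by rwa [hcK])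
  obtain ⟨c₂, h₂, b₂, s₂⟩ := efree_sum (K := K) e₂ (by rwa [hcK])
  obtain ⟨c₃, h₃, b₃, s₃⟩ := gfree_sum (by omega) hK hg hgdvd
  have hM := main_complex hKodd a b c ha hdisc c₁ c₂ c₃ h₁ h₂ h₃ _ _ _ b₁ b₂ b₃
  rw [hF] at s₃
  have hmif : (mif g).card = (UniqueFactorizationMonoid.normalizedFactors g).toFinset.card := by
    unfold mif
    congr!
  rw [hmif] at hM
  clear b₁ b₂ b₃ hmif
  generalize (2 : ℝ) ^ (UniqueFactorizationMonoid.normalizedFactors g).toFinset.card = W₃ at *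
  generalize (2 : ℝ) ^ e₁.primeFactors.card = W₁ at *
  generalize (2 : ℝ) ^ e₂.primeFactors.card = W₂ at *
  set SS := ∑ x : K, (∑ χ, c₁ χ * mcOf χ x) * (∑ χ, c₂ χ * mcOf χ (a * x ^ 2 + b * x + c)) * (∑ χ, c₃ χ * χ x) with hS
  set T₁ := (Nat.totient e₁ : ℝ) / e₁ with hT₁
  set T₂ := (Nat.totient e₂ : ℝ) / e₂ with hT₂
  set T₃ := (Nat.card ((Polynomial F ⧸ Ideal.span {g})ˣ) : ℝ) / (q : ℝ) ^ g.natDegree with hT₃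
  have p₁ : 0 ≤ T₁ := by positivity
  have p₂ : 0 ≤ T₂ := by positivity
  have p₃ : 0 ≤ T₃ := by positivity
  have hN : (NCount F a b c e₁ e₂ g : ℂ) = (T₁ * T₂ * T₃ : ℝ) * SS := by
    classical
    have k1 : (NCount F a b c e₁ e₂ g : ℂ) = ∑ α : K, (if IsEFree e₁ α then (1 : ℂ) else 0) *
        (if IsEFree e₂ (a * α ^ 2 + b * α + c) then (1 : ℂ) else 0) * (if IsGFree F g α then (1 : ℂ) else 0) := by
      rw [NCount, Nat.card_eq_fintype_card, Fintype.card_subtype, ← Finset.sum_boole]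
      refine Finset.sum_congr rfl fun α _ => ?_
      by_cases u1 : IsEFree e₁ α <;> by_cases u2 : IsEFree e₂ (a * α ^ 2 + b * α + c) <;>
        by_cases u3 : IsGFree F g α <;> simp [u1, u2, u3]
    rw [k1, hS, Finset.mul_sum]
    refine Finset.sum_congr rfl fun α _ => ?_
    have r1 := s₁ α
    have r2 := s₂ (a * α ^ 2 + b * α + c)
    have r3 := s₃ α
    have : (if IsEFree e₁ α then (1 : ℂ) else 0) *
        (if IsEFree e₂ (a * α ^ 2 + b * α + c) then (1 : ℂ) else 0) * (if IsGFree F g α then (1 : ℂ) else 0)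
        = (((Nat.totient e₁ : ℂ) / e₁) * ∑ χ, c₁ χ * mcOf χ α) * (((Nat.totient e₂ : ℂ) / e₂) * ∑ χ, c₂ χ * mcOf χ (a * α ^ 2 + b * α + c))
          * (((Nat.card ((F[X] ⧸ Ideal.span {g})ˣ) : ℂ) / (q : ℂ) ^ g.natDegree) * ∑ χ, c₃ χ * χ α) := by
      rw [← r1, ← r2, ← r3]
    rw [this, hT₁, hT₂, hT₃]
    push_cast
    ring
  have hre : (NCount F a b c e₁ e₂ g : ℝ) = (T₁ * T₂ * T₃) * SS.re := by
    have := congrArg Complex.re hN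
    rwa [Complex.re_ofReal_mul, Complex.natCast_re] at this
  have hb : (Fintype.card K : ℝ) - 3 * Real.sqrt (Fintype.card K) * (W₁ * W₂ * W₃) ≤ SS.re := by
    have := (abs_le.1 ((Complex.abs_re_le_norm _).trans hM)).1
    rw [Complex.sub_re, Complex.natCast_re] at this
    linarith
  have hcR : (Fintype.card K : ℝ) = (q : ℝ) ^ m := by rw [hcK]; push_cast; rfl
  rw [hcR] at hb
  have hsq : Real.sqrt ((q : ℝ) ^ m) * Real.sqrt ((q : ℝ) ^ m) = (q : ℝ) ^ m := Real.mul_self_sqrt (by positivity)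
  rw [hre, ge_iff_le, mul_assoc (T₁ * T₂ * T₃)]
  apply mul_le_mul_of_nonneg_left _ (by positivity)
  refine le_trans (le_of_eq ?_) hb
  rw [mul_sub, hsq]
  ring
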